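/- arXiv:1808.09754 — 2 statements merged into one kernel-verified Lean document; each statement's English description precedes it below -/
import Mathlib

section
/- Let τ > √2 and let ρ_min be a minimizing measure with support M. If p is an accumulation point of M, then K(p) ∩ M is non-empty. -/
open MeasureTheory Set
open scoped RealInnerProductSpace ENNReal

noncomputable section

/-- Euclidean three-space. -/
abbrev E3 := EuclideanSpace ℝ (Fin 3)

/-- The unit sphere `S² ⊂ ℝ³`. -/
def Sphere2 : Set E3 := Metric.sphere 0 1

/-- The function `D(x,y) = (1/4)(1+⟨x,y⟩)(2 − τ²(1−⟨x,y⟩))`. -/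
def Dfun (τ : ℝ) (x y : E3) : ℝ :=
  (1 / 4) * (1 + ⟪x, y⟫) * (2 - τ ^ 2 * (1 - ⟪x, y⟫))

/-- The Lagrangian `L = max(0, D)`. -/
def Lfun (τ : ℝ) (x y : E3) : ℝ := max 0 (Dfun τ x y)

/-- The causal action of a measure. -/
def causalAction (τ : ℝ) (ρ : Measure E3) : ℝ :=
  ∫ x, ∫ y, Lfun τ x y ∂ρ ∂ρ

/-- `ρ` is a minimizing measure: a regular Borel probability measure supported on `S²`
minimizing the causal action among all such measures. -/
def IsMinimizer (τ : ℝ) (ρ : Measure E3) : Prop :=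
  IsProbabilityMeasure ρ ∧ ρ.Regular ∧ ρ Sphere2ᶜ = 0 ∧
    ∀ ρ' : Measure E3, IsProbabilityMeasure ρ' → ρ'.Regular → ρ' Sphere2ᶜ = 0 →
      causalAction τ ρ ≤ causalAction τ ρ'

/-- The support of a measure. -/
def msupport (ρ : Measure E3) : Set E3 :=
  {x | ∀ U : Set E3, IsOpen U → x ∈ U → 0 < ρ U}

/-- The opening angle `θ_max = arccos(1 − 2/τ²)`. -/
def θmax (τ : ℝ) : ℝ := Real.arccos (1 - 2 / τ ^ 2)

/-- The open light cone `I(p)`. -/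
def lightConeI (τ : ℝ) (p : E3) : Set E3 := {q ∈ Sphere2 | 0 < Dfun τ p q}

/-- The boundary of the light cone `K(p)`. -/
def lightConeK (τ : ℝ) (p : E3) : Set E3 :=
  {q ∈ Sphere2 | ⟪p, q⟫ = Real.cos (θmax τ)}

/-- Make a point of `ℝ³` from coordinates. -/
def mkE3 (a b c : ℝ) : E3 := (WithLp.equiv 2 (Fin 3 → ℝ)).symm ![a, b, c]

/-- A totally timelike set. -/
def TotallyTimelike (τ : ℝ) (Ω : Set E3) : Prop := ∀ x ∈ Ω, ∀ y ∈ Ω, 0 < Dfun τ x y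

/-- `p` is an accumulation point of `A`: every neighborhood of `p` contains a point
of `A` different from `p`. -/
def AccumulationPt (p : E3) (A : Set E3) : Prop :=
  ∀ U ∈ nhds p, ∃ x ∈ A, x ∈ U ∧ x ≠ p

/-- `γ(0)` is a uniform two-sided accumulation point (of points of `M`) on `γ` of
scaling `β`, where `γ` is defined on `(−δ, δ)`. -/
def UniformTwoSidedAcc (M : Set E3) (β δ : ℝ) (γ : ℝ → E3) : Prop :=
  ∃ ε₀ : ℝ, 0 < ε₀ ∧ ε₀ < δ ∧ ∀ ε : ℝ, 0 < ε → ε ≤ ε₀ →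
    (∃ t ∈ Set.Ioo (-ε) (-(ε ^ (1 + β))), γ t ∈ M) ∧
    (∃ t ∈ Set.Ioo (ε ^ (1 + β)) ε, γ t ∈ M)

/-- The point `q₁ = (cos θ_max, 0, sin θ_max)`. -/
def q1pt (τ : ℝ) : E3 := mkE3 (Real.cos (θmax τ)) 0 (Real.sin (θmax τ))

/-- The point `q₂ = (cos θ_max, 0, −sin θ_max)`. -/
def q2pt (τ : ℝ) : E3 := mkE3 (Real.cos (θmax τ)) 0 (-Real.sin (θmax τ))

/-- The curve `p_s = (cos s, sin s, 0)` along the equator. -/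
def pcurve (s : ℝ) : E3 := mkE3 (Real.cos s) (Real.sin s) 0

/-- Geodesic ball in `S²` of radius `r` around `q`. -/
def geoBall (q : E3) (r : ℝ) : Set E3 := {x ∈ Sphere2 | Real.arccos ⟪q, x⟫ < r}

/-- The set `U_r = (B_r(q₁) ∪ B_r(q₂)) ∖ {q₁, q₂}`. -/
def Uset (τ r : ℝ) : Set E3 := (geoBall (q1pt τ) r ∪ geoBall (q2pt τ) r) \ {q1pt τ, q2pt τ}

/-- The set `I_r(q) = I(q) ∖ U_r`. -/
def Iset (τ r : ℝ) (q : E3) : Set E3 := lightConeI τ q \ Uset τ r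

/-- The point of `S²` with latitude `θ` (measured from the equator) and longitude `φ`. -/
def sphPt (θ φ : ℝ) : E3 :=
  mkE3 (Real.cos θ * Real.cos φ) (Real.cos θ * Real.sin φ) (Real.sin θ)

/-- The restrictions to `Ω` of polynomials of degree at most two on `ℝ³`. -/
def polyRestrictSet (Ω : Set E3) : Set (Ω → ℝ) :=
  {f | ∃ P : MvPolynomial (Fin 3) ℝ, P.totalDegree ≤ 2 ∧
        ∀ x : Ω, f x = MvPolynomial.eval (fun i => (x : E3) i) P}

/-- The space `K(Ω)` of restrictions to `Ω` of polynomials of degree at most two. -/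
def KSpace (Ω : Set E3) : Submodule ℝ (Ω → ℝ) := Submodule.span ℝ (polyRestrictSet Ω)

/-- Two-dimensional Hausdorff (surface) measure on `S²` restricted to `Ω`, as a
measure on `Ω`. -/
def surfΩ (Ω : Set E3) : Measure Ω := Measure.comap Subtype.val (μH[2] : Measure E3)

/-- The bilinear form `B(f,g) = ∫_Ω ∫_Ω D(x,y) f(x) g(y) dμ(x) dμ(y)` on functions on `Ω`. -/
def Bform (τ : ℝ) (Ω : Set E3) (f g : Ω → ℝ) : ℝ :=
  ∫ x, ∫ y, Dfun τ (x : E3) (y : E3) * f x * g y ∂(surfΩ Ω) ∂(surfΩ Ω)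

end


theorem trig_lemma (a0 a1 b1 e h m s : ℝ) (g : ℝ → ℝ)
    (hg : ∀ t, g t = a0 + a1 * Real.cos t + b1 * Real.sin t + e * Real.cos t ^ 2
      + h * (Real.sin t * Real.cos t))
    (hs : Real.cos s ≠ 1) (h0 : g 0 = m) (h1 : g s = m)
    (l0 : ∀ᶠ t in nhds (0:ℝ), m ≤ g t) (l1 : ∀ᶠ t in nhds s, m ≤ g t) : m ≤ g Real.pi := by
  have hd : ∀ t, HasDerivAt g (a1 * (-Real.sin t) + b1 * Real.cos t
      + e * (2 * Real.cos t * (-Real.sin t))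
      + h * (Real.cos t * Real.cos t + Real.sin t * (-Real.sin t))) t := by
    intro t
    have hge : g = fun t => a0 + a1 * Real.cos t + b1 * Real.sin t + e * Real.cos t ^ 2
      + h * (Real.sin t * Real.cos t) := funext hg
    rw [hge]
    have hc := Real.hasDerivAt_cos t
    have hsn := Real.hasDerivAt_sin t
    have := ((((hasDerivAt_const t a0).add (hc.const_mul a1)).add (hsn.const_mul b1)).add
      ((hc.pow 2).const_mul e)).add ((hsn.mul hc).const_mul h)
    refine HasDerivAt.congr_deriv this ?_
    norm_num
  have m0 : IsLocalMin g 0 := by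
    show ∀ᶠ t in nhds (0:ℝ), g 0 ≤ g t
    rw [h0]; exact l0
  have m1 : IsLocalMin g s := by
    show ∀ᶠ t in nhds s, g s ≤ g t
    rw [h1]; exact l1
  have d0 := m0.hasDerivAt_eq_zero (hd 0)
  have d1 := m1.hasDerivAt_eq_zero (hd s)
  rw [hg] at h0 h1
  simp at d0 h0
  set c := Real.cos s with hc
  set σ := Real.sin s with hσ
  have hcs : σ ^ 2 + c ^ 2 = 1 := Real.sin_sq_add_cos_sq s
  have hb : b1 = -h := by linarith
  have ha : a0 = m - a1 - e := by linarith
  subst hb; subst ha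
  have hc1 : c - 1 ≠ 0 := sub_ne_zero.mpr hs
  have e1 : a1 + e * (c + 1) + h * σ = 0 := by
    apply mul_left_cancel₀ hc1
    linear_combination h1
  have ha1 : a1 = - e * (c + 1) - h * σ := by linarith
  subst ha1
  -- relation
  have e2 : e * σ - h * c = 0 := by
    apply mul_left_cancel₀ hc1
    linear_combination (-1) * d1 
  -- k
  obtain ⟨k, hk1, hk2⟩ : ∃ k, e = k * c ∧ h = k * σ := by
    refine ⟨e * c + h * σ, ?_, ?_⟩
    · linear_combination (-e) * hcs + σ * e2
    · linear_combination (-h) * hcs - c * e2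
  subst hk1; subst hk2
  have hfac : ∀ t, g t = m + k * ((1 - Real.cos t) * (1 - Real.cos (t - s))) := by
    intro t
    rw [hg, Real.cos_sub, ← hc, ← hσ]
    linear_combination (k * (1 - Real.cos t)) * hcs
  have hk : 0 ≤ k := by
    have hcont : ∀ᶠ t in nhds (0:ℝ), 0 < 1 - Real.cos (t - s) := by
      have : ContinuousAt (fun t => 1 - Real.cos (t - s)) 0 := by fun_prop
      apply this.eventually_const_lt
      simp only [zero_sub, Real.cos_neg]
      have := Real.cos_le_one s
      have := lt_of_le_of_ne this hs
      linarith
    obtain ⟨δ, hδ, hb⟩ := Metric.eventually_nhds_iff.mp (l0.and hcont)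
    set t := min (δ/2) 1
    have ht : 0 < t := by positivity
    have ht1 : t < δ := lt_of_le_of_lt (min_le_left _ _) (by linarith)
    have ht2 : t ≤ 1 := min_le_right _ _
    obtain ⟨q1, q2⟩ := @hb t (by simp [abs_of_pos ht, ht1])
    rw [hfac] at q1
    have hct : Real.cos t < 1 := by
      have := Real.cos_lt_cos_of_nonneg_of_le_pi (le_refl 0) (by linarith [Real.pi_gt_three]) ht
      simpa using this
    have : 0 < (1 - Real.cos t) * (1 - Real.cos (t - s)) := mul_pos (by linarith) q2
    nlinarith
  rw [hfac]
  have : 0 ≤ (1 - Real.cos Real.pi) * (1 - Real.cos (Real.pi - s)) :=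
    mul_nonneg (by linarith [Real.cos_le_one Real.pi]) (by linarith [Real.cos_le_one (Real.pi - s)])
  nlinarith

theorem pot_cont (K : E3 → E3 → ℝ) (hK : Continuous (fun z : E3 × E3 => K z.1 z.2))
    (hb : ∀ x y, |K x y| ≤ 1) (ρ : Measure E3) [IsProbabilityMeasure ρ] :
    Continuous (fun x => ∫ z, K x z ∂ρ) ∧ Integrable (fun x => ∫ z, K x z ∂ρ) ρ ∧
    ∀ x, Integrable (K x) ρ := by
  have hKx : ∀ x, Continuous (K x) := fun x => hK.comp (by fun_prop : Continuous fun z => (x, z))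
  have cl : Continuous (fun x => ∫ z, K x z ∂ρ) := by
    apply continuous_of_dominated (bound := fun _ => 1)
    · exact fun x => (hKx x).aestronglyMeasurable
    · exact fun x => Filter.Eventually.of_forall (hb x)
    · exact integrable_const _
    · refine Filter.Eventually.of_forall fun z => hK.comp (by fun_prop : Continuous fun x => (x, z))
  have bl : ∀ x, ‖∫ z, K x z ∂ρ‖ ≤ 1 := by
    intro x
    have := norm_integral_le_of_norm_le_const (μ := ρ) (f := K x) (C := 1)
      (Filter.Eventually.of_forall (hb x))
    simpa using this
  exact ⟨cl, Integrable.of_bound cl.aestronglyMeasurable 1 (Filter.Eventually.of_forall bl),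
    fun x => Integrable.of_bound (hKx x).aestronglyMeasurable 1
      (Filter.Eventually.of_forall (hb x))⟩

theorem el_lemma (K : E3 → E3 → ℝ) (hK : Continuous (fun z : E3 × E3 => K z.1 z.2))
    (hb : ∀ x y, |K x y| ≤ 1) (hsym : ∀ x y, K x y = K y x)
    (ρ : Measure E3) [IsProbabilityMeasure ρ] (y : E3)
    (h : ∀ t : NNReal, t ≤ 1 →
      ∫ x, ∫ z, K x z ∂ρ ∂ρ ≤ ∫ x, ∫ z, K x z ∂((1 - t) • ρ + t • Measure.dirac y)
        ∂((1 - t) • ρ + t • Measure.dirac y)) :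
    ∫ x, ∫ z, K x z ∂ρ ∂ρ ≤ ∫ z, K y z ∂ρ := by
  have hKx : ∀ x, Continuous (K x) := fun x => hK.comp (by fun_prop : Continuous fun z => (x, z))
  have iK : ∀ (μ : Measure E3) [IsFiniteMeasure μ] x, Integrable (K x) μ := fun μ _ x =>
    Integrable.of_bound (hKx x).aestronglyMeasurable 1 (Filter.Eventually.of_forall (hb x))
  have cl : Continuous (fun x => ∫ z, K x z ∂ρ) := by
    apply continuous_of_dominated (bound := fun _ => 1)
    · exact fun x => (hKx x).aestronglyMeasurable
    · exact fun x => Filter.Eventually.of_forall (hb x)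
    · exact integrable_const _
    · refine Filter.Eventually.of_forall fun z => hK.comp (by fun_prop : Continuous fun x => (x, z))
  have bl : ∀ x, ‖∫ z, K x z ∂ρ‖ ≤ 1 := by
    intro x
    have := norm_integral_le_of_norm_le_const (μ := ρ) (f := K x) (C := 1)
      (Filter.Eventually.of_forall (hb x))
    simpa using this
  have il : ∀ (μ : Measure E3) [IsFiniteMeasure μ], Integrable (fun x => ∫ z, K x z ∂ρ) μ :=
    fun μ _ => Integrable.of_bound cl.aestronglyMeasurable 1 (Filter.Eventually.of_forall bl)
  set S := ∫ x, ∫ z, K x z ∂ρ ∂ρ with hS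
  set l := ∫ z, K y z ∂ρ with hl
  have key : ∀ t : NNReal, t ≤ 1 → S ≤ (1 - t) * ((1 - t) * S + t * l) + t * ((1 - t) * l + t * K y y) := by
    intro t ht
    refine (h t ht).trans (le_of_eq ?_)
    have hin : ∀ x, ∫ z, K x z ∂((1 - t) • ρ + t • Measure.dirac y)
        = (1 - t) * (∫ z, K x z ∂ρ) + t * K y x := by
      intro x
      rw [integral_add_measure (iK _ x) (iK _ x), integral_smul_nnreal_measure,
        integral_smul_nnreal_measure, integral_dirac, hsym x y]
      simp [NNReal.smul_def, NNReal.coe_sub ht]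
    simp_rw [hin]
    have i2 : ∀ (μ : Measure E3) [IsFiniteMeasure μ],
        Integrable (fun x => (1 - (t:ℝ)) * (∫ z, K x z ∂ρ) + t * K y x) μ := fun μ _ =>
      ((il μ).const_mul _).add ((iK μ y).const_mul _)
    rw [integral_add_measure (i2 _) (i2 _), integral_smul_nnreal_measure,
        integral_smul_nnreal_measure, integral_dirac,
        integral_add ((il ρ).const_mul _) ((iK ρ y).const_mul _), integral_const_mul,
        integral_const_mul]
    simp only [NNReal.smul_def, NNReal.coe_sub ht, smul_eq_mul, NNReal.coe_one]
    ring
  by_contra hlt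
  push Not at hlt
  have hKy := (abs_le.mp (hb y y)).2
  -- S - l > 0 ; for small t contradiction
  have hl1 := abs_le.mp (bl y)
  have hS1 : |S| ≤ 1 := by
    have := norm_integral_le_of_norm_le_const (μ := ρ) (f := fun x => ∫ z, K x z ∂ρ) (C := 1)
      (Filter.Eventually.of_forall bl)
    simpa using this
  have hS2 := abs_le.mp hS1
  set ε := S - l with hε
  have hε0 : 0 < ε := by linarith
  have hε2 : ε ≤ 2 := by linarith
  have := key (Real.toNNReal (ε / 4)) (by rw [Real.toNNReal_le_one]; linarith)
  rw [Real.coe_toNNReal _ (by positivity)] at this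
  have hl' : l = S - ε := by linarith
  change S ≤ (1 - ε/4) * ((1 - ε/4) * S + ε/4 * l) + ε/4 * ((1 - ε/4) * l + ε/4 * K y y) at this
  rw [hl'] at this
  have h3 : 0 ≤ (ε/4) * (-2 * ε + 2 * ε * (ε/4) + (ε/4) * (K y y - S)) := by
    nlinarith
  have h4 : -2 * ε + 2 * ε * (ε/4) + (ε/4) * (K y y - S) < 0 := by
    nlinarith
  nlinarith

/-- clipped kernel -/
noncomputable def Kclip (τ : ℝ) (x y : E3) : ℝ :=
  max 0 ((1 / 4) * (1 + max (-1) (min 1 ⟪x, y⟫)) * (2 - τ ^ 2 * (1 - max (-1) (min 1 ⟪x, y⟫))))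

theorem Kclip_cont (τ : ℝ) : Continuous (fun z : E3 × E3 => Kclip τ z.1 z.2) := by
  unfold Kclip
  fun_prop

theorem Kclip_nonneg (τ : ℝ) (x y : E3) : 0 ≤ Kclip τ x y := le_max_left _ _

theorem Kclip_bound (τ : ℝ) (x y : E3) : |Kclip τ x y| ≤ 1 := by
  rw [abs_of_nonneg (Kclip_nonneg _ _ _)]
  unfold Kclip
  set t := max (-1) (min 1 ⟪x, y⟫) with ht
  have h1 : -1 ≤ t := le_max_left _ _
  have h2 : t ≤ 1 := max_le (by norm_num) (min_le_left _ _)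
  apply max_le (by norm_num)
  have h3 : 0 ≤ τ ^ 2 * (1 - t) := mul_nonneg (sq_nonneg _) (by linarith)
  nlinarith

theorem Kclip_symm (τ : ℝ) (x y : E3) : Kclip τ x y = Kclip τ y x := by
  unfold Kclip
  rw [real_inner_comm]

theorem inner_bounds {x y : E3} (hx : x ∈ Sphere2) (hy : y ∈ Sphere2) :
    -1 ≤ (⟪x, y⟫ : ℝ) ∧ (⟪x, y⟫ : ℝ) ≤ 1 := by
  have h := abs_real_inner_le_norm x y
  simp [Sphere2] at hx hy
  rw [hx, hy] at h
  exact abs_le.mp (by simpa using h)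

theorem Kclip_eq (τ : ℝ) {x y : E3} (hx : x ∈ Sphere2) (hy : y ∈ Sphere2) :
    Lfun τ x y = Kclip τ x y := by
  obtain ⟨h1, h2⟩ := inner_bounds hx hy
  unfold Kclip Lfun Dfun
  rw [min_eq_right h2, max_eq_right h1]

theorem action_eq (τ : ℝ) (ρ : Measure E3) (h : ρ Sphere2ᶜ = 0) :
    causalAction τ ρ = ∫ x, ∫ z, Kclip τ x z ∂ρ ∂ρ := by
  have hae : ∀ᵐ x ∂ρ, x ∈ Sphere2 := h
  unfold causalAction
  apply integral_congr_ae
  filter_upwards [hae] with x hx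
  apply integral_congr_ae
  filter_upwards [hae] with y hy
  exact Kclip_eq τ hx hy

theorem el_ge (τ : ℝ) (ρ : Measure E3) (hmin : IsMinimizer τ ρ) (y : E3) (hy : y ∈ Sphere2) :
    causalAction τ ρ ≤ ∫ z, Kclip τ y z ∂ρ := by
  obtain ⟨hP, hR, h0, hm⟩ := hmin
  rw [action_eq τ ρ h0]
  apply el_lemma (Kclip τ) (Kclip_cont τ) (Kclip_bound τ) (Kclip_symm τ)
  intro t ht
  have h0' : ((1 - t) • ρ + t • Measure.dirac y) Sphere2ᶜ = 0 := by
    have : Measure.dirac y Sphere2ᶜ = 0 := by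
      rw [Measure.dirac_apply' _ (by unfold Sphere2; exact Metric.isClosed_sphere.measurableSet.compl)]
      simp [hy]
    simp [h0, this]
  rw [← action_eq τ ρ h0, ← action_eq τ _ h0']
  have hp' : IsProbabilityMeasure ((1 - t) • ρ + t • Measure.dirac y) := by
    constructor
    simp only [Measure.add_apply, Measure.smul_apply, measure_univ]
    rw [← add_smul, tsub_add_cancel_of_le ht]
    simp
  exact hm _ hp' inferInstance h0'

theorem el_eq (τ : ℝ) (ρ : Measure E3) (hmin : IsMinimizer τ ρ) (x : E3) (hx : x ∈ msupport ρ) :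
    ∫ z, Kclip τ x z ∂ρ = causalAction τ ρ := by
  have hge := el_ge τ ρ hmin
  obtain ⟨hP, hR, h0, hm⟩ := hmin
  obtain ⟨cl, il, -⟩ := pot_cont (Kclip τ) (Kclip_cont τ) (Kclip_bound τ) ρ
  have hae : ∀ᵐ x ∂ρ, x ∈ Sphere2 := h0
  set S := causalAction τ ρ with hS
  have hint : ∫ x, ((∫ z, Kclip τ x z ∂ρ) - S) ∂ρ = 0 := by
    rw [integral_sub il (integrable_const _), ← action_eq τ ρ h0]
    simp [hS]
  have hz := (integral_eq_zero_iff_of_nonneg_ae (by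
    filter_upwards [hae] with y hy
    have := hge y hy
    simpa using this) (il.sub (integrable_const _))).mp hint
  by_contra hne
  have ho : IsOpen {y | ∫ z, Kclip τ y z ∂ρ ≠ S} := isOpen_ne_fun cl continuous_const
  have hpos := hx _ ho hne
  have : ρ {y | ∫ z, Kclip τ y z ∂ρ ≠ S} = 0 := by
    have h2 : ∀ᵐ y ∂ρ, ∫ z, Kclip τ y z ∂ρ = S := by
      filter_upwards [hz] with y hy
      have : (∫ z, Kclip τ y z ∂ρ) - S = 0 := hy
      linarith
    exact h2
  exact hpos.ne' this

theorem msupport_eq (ρ : Measure E3) : msupport ρ = ρ.support := by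
  ext x
  rw [Measure.mem_support_iff_forall]
  constructor
  · intro h U hU
    obtain ⟨V, hV, hVo, hxV⟩ := mem_nhds_iff.mp hU
    exact (h V hVo hxV).trans_le (measure_mono hV)
  · intro h U hU hx
    exact h U (hU.mem_nhds hx)

theorem pos_lemma (K : E3 → E3 → ℝ) (hK : Continuous (fun z : E3 × E3 => K z.1 z.2))
    (hb : ∀ x y, |K x y| ≤ 1) (h0 : ∀ x y, 0 ≤ K x y) (ρ : Measure E3) [IsProbabilityMeasure ρ]
    (p : E3) (hpM : p ∈ msupport ρ) (hpp : K p p ≠ 0) : 0 < ∫ z, K p z ∂ρ := by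
  obtain ⟨-, -, iK⟩ := pot_cont K hK hb ρ
  rw [integral_pos_iff_support_of_nonneg (h0 p) (iK p)]
  have hKx : Continuous (K p) := hK.comp (by fun_prop : Continuous fun z => (p, z))
  exact hpM _ hKx.isOpen_support hpp

theorem f_trig (τ : ℝ) (ν : Measure E3) [IsFiniteMeasure ν] (hν : ∀ᵐ y ∂ν, y ∈ Sphere2)
    (p e : E3) (hp : ‖p‖ = 1) (he : ‖e‖ = 1) :
    ∃ a0 a1 b1 e' h : ℝ, ∀ t, ∫ y, Dfun τ (Real.cos t • p + Real.sin t • e) y ∂ν =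
      a0 + a1 * Real.cos t + b1 * Real.sin t + e' * Real.cos t ^ 2
      + h * (Real.sin t * Real.cos t) := by
  have bd : ∀ w : E3, ‖w‖ = 1 → ∀ᵐ y ∂ν, |(⟪w, y⟫ : ℝ)| ≤ 1 := by
    intro w hw
    filter_upwards [hν] with y hy
    exact abs_le.mpr (inner_bounds (by simp [Sphere2, hw]) hy)
  have i1 : ∀ w : E3, ‖w‖ = 1 → Integrable (fun y => (⟪w, y⟫ : ℝ)) ν := fun w hw =>
    Integrable.of_bound (by fun_prop) 1 (bd w hw)
  have i2 : ∀ w w' : E3, ‖w‖ = 1 → ‖w'‖ = 1 →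
      Integrable (fun y => (⟪w, y⟫ : ℝ) * ⟪w', y⟫) ν := by
    intro w w' hw hw'
    refine Integrable.of_bound (by fun_prop) 1 ?_
    filter_upwards [bd w hw, bd w' hw'] with y h1 h2
    rw [Real.norm_eq_abs, abs_mul]
    exact mul_le_one₀ h1 (abs_nonneg _) h2
  refine ⟨∫ y, (2 - τ ^ 2) / 4 ∂ν + τ ^ 2 / 4 * ∫ y, (⟪e, y⟫ : ℝ) * ⟪e, y⟫ ∂ν,
    1 / 2 * ∫ y, (⟪p, y⟫ : ℝ) ∂ν, 1 / 2 * ∫ y, (⟪e, y⟫ : ℝ) ∂ν,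
    τ ^ 2 / 4 * (∫ y, (⟪p, y⟫ : ℝ) * ⟪p, y⟫ ∂ν - ∫ y, (⟪e, y⟫ : ℝ) * ⟪e, y⟫ ∂ν),
    τ ^ 2 / 2 * ∫ y, (⟪p, y⟫ : ℝ) * ⟪e, y⟫ ∂ν, fun t => ?_⟩
  set c := Real.cos t
  set s := Real.sin t
  have hcs : s ^ 2 + c ^ 2 = 1 := Real.sin_sq_add_cos_sq t
  have hfun : (fun y => Dfun τ (c • p + s • e) y) = fun y =>
      (2 - τ ^ 2) / 4 + ((c / 2) * (⟪p, y⟫ : ℝ) + ((s / 2) * (⟪e, y⟫ : ℝ) +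
      ((τ ^ 2 / 4 * c ^ 2) * ((⟪p, y⟫ : ℝ) * ⟪p, y⟫) +
      ((τ ^ 2 / 2 * (s * c)) * ((⟪p, y⟫ : ℝ) * ⟪e, y⟫) +
      (τ ^ 2 / 4 * s ^ 2) * ((⟪e, y⟫ : ℝ) * ⟪e, y⟫))))) := by
    funext y
    simp only [Dfun, inner_add_left, real_inner_smul_left]
    ring
  have j1 := (i1 p hp).const_mul (c / 2)
  have j2 := (i1 e he).const_mul (s / 2)
  have j3 := (i2 p p hp hp).const_mul (τ ^ 2 / 4 * c ^ 2)
  have j4 := (i2 p e hp he).const_mul (τ ^ 2 / 2 * (s * c))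
  have j5 := (i2 e e he he).const_mul (τ ^ 2 / 4 * s ^ 2)
  have k4 := j4.fun_add j5
  have k3 := j3.fun_add k4
  have k2 := j2.fun_add k3
  have k1 := j1.fun_add k2
  rw [hfun, integral_add (integrable_const _) k1, integral_add j1 k2,
    integral_add j2 k3, integral_add j3 k4, integral_add j4 j5,
    integral_const_mul, integral_const_mul, integral_const_mul, integral_const_mul,
    integral_const_mul]
  linear_combination (τ ^ 2 / 4 * ∫ y, (⟪e, y⟫ : ℝ) * ⟪e, y⟫ ∂ν) * hcs

/-- Lemma 5.3: for `τ > √2`, if `p` is an accumulation point of `M`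
then `K(p) ∩ M ≠ ∅`. -/
theorem stmt_9 (τ : ℝ) (hτ : Real.sqrt 2 < τ) (ρ : Measure E3) (hmin : IsMinimizer τ ρ)
    (p : E3) (hp : p ∈ Sphere2) (hacc : AccumulationPt p (msupport ρ)) :
    (lightConeK τ p ∩ msupport ρ).Nonempty := by
  by_contra hempty
  have hge := el_ge τ ρ hmin
  have heq := el_eq τ ρ hmin
  obtain ⟨hP, hR, h0, -⟩ := hmin
  have hτ2 : 2 < τ ^ 2 := (Real.sqrt_lt' ((Real.sqrt_nonneg 2).trans_lt hτ)).mp hτ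
  set t0 : ℝ := 1 - 2 / τ ^ 2 with ht0
  have ht0τ : τ ^ 2 * (1 - t0) = 2 := by
    have : τ ^ 2 ≠ 0 := by positivity
    rw [ht0, sub_sub_cancel, mul_div_cancel₀ _ this]
  have ht0pos : 0 < t0 := by nlinarith
  have ht01 : t0 < 1 := by nlinarith
  have hcos : Real.cos (θmax τ) = t0 := Real.cos_arccos (by linarith) ht01.le
  have hD : ∀ x y : E3, Dfun τ x y = τ ^ 2 / 4 * ((1 + ⟪x, y⟫) * (⟪x, y⟫ - t0)) := by
    intro x y
    unfold Dfun
    linear_combination (-(1 + ⟪x, y⟫) / 4) * ht0τ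
  have hae : ∀ᵐ x ∂ρ, x ∈ Sphere2 := h0
  have hMs : msupport ρ ⊆ Sphere2 := by
    rw [msupport_eq]
    exact Measure.support_subset_of_isClosed Metric.isClosed_sphere hae
  have hMc : IsClosed (msupport ρ) := by
    rw [msupport_eq]; exact Measure.isClosed_support
  have hMk : IsCompact (msupport ρ) :=
    (isCompact_sphere (0 : E3) 1).of_isClosed_subset hMc hMs
  have hMae : ∀ᵐ x ∂ρ, x ∈ msupport ρ := by
    rw [msupport_eq]; exact Measure.support_mem_ae
  have hpM : p ∈ msupport ρ := by
    rw [← hMc.closure_eq, mem_closure_iff_nhds]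
    intro U hU
    obtain ⟨x, hx, hxU, -⟩ := hacc U hU
    exact ⟨x, hxU, hx⟩
  have hpn : ‖p‖ = 1 := by simpa [Sphere2] using hp
  -- gap
  obtain ⟨δ, hδ, hgap⟩ : ∃ δ > 0, ∀ y ∈ msupport ρ, δ ≤ |(⟪p, y⟫ : ℝ) - t0| := by
    obtain ⟨y0, hy0, hmin0⟩ := hMk.exists_isMinOn ⟨p, hpM⟩
      (f := fun y => |(⟪p, y⟫ : ℝ) - t0|) (by fun_prop)
    refine ⟨_, ?_, fun y hy => hmin0 hy⟩
    apply abs_pos.mpr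
    intro h
    exact hempty ⟨y0, ⟨hMs hy0, by rw [hcos]; linarith⟩, hy0⟩
  set J : Set E3 := {y | t0 < (⟪p, y⟫ : ℝ)} with hJ
  have hJm : MeasurableSet J :=
    (isOpen_lt continuous_const (by fun_prop)).measurableSet
  set ν := ρ.restrict J with hν
  have hloc : ∀ x ∈ Sphere2, x ∈ Metric.ball p δ →
      ∫ z, Kclip τ x z ∂ρ = ∫ y, Dfun τ x y ∂ν := by
    intro x hx hxb
    rw [hν, ← integral_indicator hJm]
    apply integral_congr_ae
    filter_upwards [hMae] with y hy
    have hys := hMs hy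
    have hyn : ‖y‖ = 1 := by simpa [Sphere2] using hys
    rw [← Kclip_eq τ hx hys]
    have hb := inner_bounds hx hys
    have hd : |(⟪x, y⟫ : ℝ) - ⟪p, y⟫| < δ := by
      rw [← inner_sub_left]
      refine (abs_real_inner_le_norm _ _).trans_lt ?_
      rw [hyn, mul_one, ← dist_eq_norm]; exact hxb
    have hd' := abs_lt.mp hd
    have hg := hgap y hy
    unfold Lfun
    by_cases hyJ : y ∈ J
    · rw [Set.indicator_of_mem hyJ]
      have hyJ' : t0 < (⟪p, y⟫ : ℝ) := hyJ
      rw [abs_of_pos (by linarith)] at hg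
      apply max_eq_right
      rw [hD]
      exact mul_nonneg (by positivity) (mul_nonneg (by linarith) (by linarith))
    · rw [Set.indicator_of_notMem hyJ]
      have hyJ' : (⟪p, y⟫ : ℝ) ≤ t0 := not_lt.mp hyJ
      rw [abs_of_nonpos (by linarith)] at hg
      apply max_eq_left
      rw [hD]
      exact mul_nonpos_of_nonneg_of_nonpos (by positivity)
        (mul_nonpos_of_nonneg_of_nonpos (by linarith) (by linarith))
  -- second point
  obtain ⟨q, hqM, hqb, hqp⟩ := hacc (Metric.ball p (min δ 1)) (Metric.ball_mem_nhds _ (by positivity))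
  have hqδ : q ∈ Metric.ball p δ := Metric.ball_subset_ball (min_le_left _ _) hqb
  have hq1 : q ∈ Metric.ball p 1 := Metric.ball_subset_ball (min_le_right _ _) hqb
  have hqs := hMs hqM
  have hqn : ‖q‖ = 1 := by simpa [Sphere2] using hqs
  set c : ℝ := ⟪p, q⟫ with hc
  have hnsq : ‖q - p‖ ^ 2 = 2 - 2 * c := by
    rw [norm_sub_sq_real, hqn, hpn, real_inner_comm]; ring
  have hc1 : c < 1 := by
    have : 0 < ‖q - p‖ := norm_pos_iff.mpr (sub_ne_zero.mpr hqp)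
    nlinarith
  have hc0 : 0 < c := by
    have : ‖q - p‖ < 1 := by rw [← dist_eq_norm]; exact hq1
    have := norm_nonneg (q - p)
    nlinarith
  set s := Real.arccos c with hs
  have hcs : Real.cos s = c := Real.cos_arccos (by linarith) hc1.le
  have hss : 0 < Real.sin s := by
    rw [hs, Real.sin_arccos]
    apply Real.sqrt_pos.mpr
    nlinarith
  have hsc := Real.sin_sq_add_cos_sq s
  rw [hcs] at hsc
  set e : E3 := (Real.sin s)⁻¹ • (q - c • p) with he
  have hpp : (⟪p, p⟫ : ℝ) = 1 := by rw [real_inner_self_eq_norm_sq, hpn]; norm_num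
  have hqq : (⟪q, q⟫ : ℝ) = 1 := by rw [real_inner_self_eq_norm_sq, hqn]; norm_num
  have hpe : (⟪p, e⟫ : ℝ) = 0 := by
    rw [he, real_inner_smul_right, inner_sub_right, real_inner_smul_right, hpp, ← hc]; ring
  have hee : (⟪e, e⟫ : ℝ) = 1 := by
    rw [he, real_inner_smul_right, real_inner_smul_left, inner_sub_right, inner_sub_left,
      inner_sub_left, real_inner_smul_right, real_inner_smul_right, real_inner_smul_left,
      real_inner_smul_left, hpp, hqq, real_inner_comm p q, ← hc]
    field_simp
    linear_combination -hsc
  have hen : ‖e‖ = 1 := by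
    have := real_inner_self_eq_norm_sq e
    rw [hee] at this
    nlinarith [norm_nonneg e]
  set γ : ℝ → E3 := fun t => Real.cos t • p + Real.sin t • e with hγ
  have hγs : ∀ t, γ t ∈ Sphere2 := by
    intro t
    have : ‖γ t‖ ^ 2 = 1 := by
      rw [hγ]
      simp only [norm_add_sq_real, real_inner_smul_left, real_inner_smul_right, hpe, norm_smul,
        hpn, hen, Real.norm_eq_abs]
      have := Real.sin_sq_add_cos_sq t
      rw [mul_one, mul_one, sq_abs, sq_abs]
      linarith
    have h1 : ‖γ t‖ = 1 := by nlinarith [norm_nonneg (γ t)]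
    simpa [Sphere2] using h1
  have hγc : Continuous γ := by
    rw [hγ]; fun_prop
  have hγ0 : γ 0 = p := by simp [hγ]
  have hγq : γ s = q := by
    simp only [hγ, he, hcs, smul_smul, mul_inv_cancel₀ hss.ne', one_smul]
    abel
  have hγπ : γ Real.pi = -p := by simp [hγ]
  have hνae : ∀ᵐ y ∂ν, y ∈ Sphere2 := ae_restrict_of_ae hae
  obtain ⟨a0, a1, b1, e', h, hg⟩ := f_trig τ ν hνae p e hpn hen
  set S := causalAction τ ρ with hS
  have hnear : ∀ t1, γ t1 ∈ Metric.ball p δ → ∀ᶠ t in nhds t1, S ≤ ∫ y, Dfun τ (γ t) y ∂ν := by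
    intro t1 h1
    filter_upwards [hγc.continuousAt.preimage_mem_nhds (Metric.isOpen_ball.mem_nhds h1)] with t ht
    rw [← hloc _ (hγs t) ht]
    exact hge _ (hγs t)
  have hpb : p ∈ Metric.ball p δ := Metric.mem_ball_self hδ
  have hfinal := trig_lemma a0 a1 b1 e' h S s (fun t => ∫ y, Dfun τ (γ t) y ∂ν) hg
    (by rw [hcs]; exact hc1.ne)
    (by show ∫ y, Dfun τ (γ 0) y ∂ν = S
        rw [hγ0, ← hloc p hp hpb]; exact heq p hpM)
    (by show ∫ y, Dfun τ (γ s) y ∂ν = S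
        rw [hγq, ← hloc q hqs hqδ]; exact heq q hqM)
    (hnear 0 (by rw [hγ0]; exact hpb)) (hnear s (by rw [hγq]; exact hqδ))
  have hneg : ∫ y, Dfun τ (γ Real.pi) y ∂ν ≤ 0 := by
    apply integral_nonpos_of_ae
    filter_upwards [hνae, ae_restrict_mem hJm] with y hy hyJ
    have hyJ' : t0 < (⟪p, y⟫ : ℝ) := hyJ
    have := inner_bounds hp hy
    show Dfun τ (γ Real.pi) y ≤ 0
    rw [hD, hγπ, inner_neg_left]
    exact mul_nonpos_of_nonneg_of_nonpos (by positivity)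
        (mul_nonpos_of_nonneg_of_nonpos (by linarith) (by linarith))
  have hSpos : 0 < S := by
    rw [← heq p hpM]
    refine pos_lemma (Kclip τ) (Kclip_cont τ) (Kclip_bound τ) (Kclip_nonneg τ) ρ p hpM ?_
    rw [← Kclip_eq τ hp hp]
    unfold Lfun Dfun
    rw [hpp]
    norm_num
  have hfinal' : S ≤ ∫ y, Dfun τ (γ Real.pi) y ∂ν := hfinal
  linarith
end

section
/- Let τ > √3, let β > 0, and let ρ_min be a minimizing measure with support M. Assume that there exist no point p ∈ M, no δ > 0 and no real analytic curve γ : (−δ, δ) → S² parametrized by arc length with γ(0) = p such that p is a uniform two-sided accumulation point on γ of scaling β. Then the Hausdorff dimension of M is at most 1/(1+β). -/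
open MeasureTheory Set
open scoped RealInnerProductSpace ENNReal

open Filter Topology in
lemma right_gap_dim (β : ℝ) (hβ : 0 < β) (a b : ℝ) (T : Set ℝ) (hT : T ⊆ Set.Icc a b)
    (h : ∀ t ∈ T, ∀ η : ℝ, 0 < η → ∃ ε, 0 < ε ∧ ε ≤ η ∧
      ∀ s ∈ T, ¬ (t + ε ^ (1 + β) < s ∧ s < t + ε)) :
    dimH T ≤ ENNReal.ofReal (1 / (1 + β)) := by
  have hb : 0 < 1 + β := by linarith
  have key : ∀ n : ℕ, ∃ (u : Set ℝ) (e : ℝ → ℝ), u.Countable ∧ (∀ t ∈ u, 0 < e t ∧ e t ≤ 1 / ((n:ℝ) + 1)) ∧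
      T ⊆ ⋃ t : u, Metric.closedBall (t:ℝ) (5 * e t ^ (1 + β)) ∧
      ∑' t : u, ENNReal.ofReal (e t) ≤ ENNReal.ofReal (b + 1 - a) := by
    intro n
    have hn : (0:ℝ) < 1 / ((n:ℝ) + 1) := by positivity
    choose! e he0 he1 he2 using fun t ht => h t ht (1 / ((n:ℝ) + 1)) hn
    have hle : ∀ t ∈ T, e t ≤ 1 := fun t ht => (he1 t ht).trans (by
      rw [div_le_one (by positivity)]; have : (0:ℝ) ≤ n := by positivity
      linarith)
    obtain ⟨u, huT, hdis, hcov⟩ := Vitali.exists_disjoint_subfamily_covering_enlargement_closedBall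
      T (fun t : ℝ => t) (fun t => e t ^ (1 + β)) 1
      (fun t ht => Real.rpow_le_one (he0 t ht).le (hle t ht) hb.le) 5 (by norm_num)
    have hlt : ∀ s ∈ u, ∀ t ∈ u, s < t → s + e s ≤ t := by
      intro s hs t ht hst
      by_contra hc
      push Not at hc
      have h1 := he2 s (huT hs) t (huT ht)
      have h2 : t ≤ s + e s ^ (1 + β) := by
        by_contra h3
        push Not at h3
        exact h1 ⟨h3, hc⟩
      have := hdis hs ht hst.ne
      have h3 : (0:ℝ) < e t ^ (1 + β) := Real.rpow_pos_of_pos (he0 t (huT ht)) _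
      refine absurd (a := t ∈ Metric.closedBall t (e t ^ (1 + β))) ?_ (Set.disjoint_left.1 this ?_)
      · simp [h3.le]
      · simp only [Metric.mem_closedBall, Real.dist_eq]
        rw [abs_le]; constructor <;> linarith
    have hd2 : u.PairwiseDisjoint (fun t => Set.Ioo t (t + e t)) := by
      intro s hs t ht hst
      refine Set.disjoint_left.2 ?_
      rintro x ⟨h1, h2⟩ ⟨h3, h4⟩
      rcases lt_or_gt_of_ne hst with h | h
      · have := hlt s hs t ht h; linarith
      · have := hlt t ht s hs h; linarith
    have hcount : u.Countable := hd2.countable_of_isOpen (fun t _ => isOpen_Ioo)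
      (fun t ht => ⟨t + e t / 2, by constructor <;> linarith [he0 t (huT ht)]⟩)
    refine ⟨u, e, hcount, fun t ht => ⟨he0 t (huT ht), he1 t (huT ht)⟩, ?_, ?_⟩
    · intro t ht
      obtain ⟨c, hc, hsub⟩ := hcov t ht
      have h3 : (0:ℝ) < e t ^ (1 + β) := Real.rpow_pos_of_pos (he0 t ht) _
      exact Set.mem_iUnion.2 ⟨⟨c, hc⟩, hsub (by simp [h3.le])⟩
    · have h1 := measure_biUnion (μ := (volume : Measure ℝ)) hcount hd2 (fun t _ => measurableSet_Ioo)
      have h2 : (volume : Measure ℝ) (⋃ t ∈ u, Set.Ioo t (t + e t)) ≤ volume (Set.Icc a (b+1)) := by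
        apply measure_mono
        intro x hx
        simp only [Set.mem_iUnion] at hx
        obtain ⟨t, ht, h1, h2⟩ := hx
        have := hT (huT ht)
        have := hle t (huT ht)
        constructor
        · linarith [(hT (huT ht)).1]
        · linarith [(hT (huT ht)).2]
      rw [h1] at h2
      simpa using h2
  choose u e hu he hcov hsum using key
  have hcn : ∀ n, Countable (u n) := fun n => (hu n).to_subtype
  set d : ℝ := 1 / (1 + β) with hd
  have hd0 : 0 < d := by positivity
  have hdiam : ∀ n, ∀ t : u n, Metric.ediam (Metric.closedBall (t:ℝ) (5 * e n t ^ (1 + β)))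
      = ENNReal.ofReal (10 * e n t ^ (1 + β)) := by
    intro n t
    rw [Real.closedBall_eq_Icc, Real.ediam_Icc]
    congr 1; ring
  have hmain := Measure.hausdorffMeasure_le_liminf_tsum (ι := fun n => u n) d T (l := atTop)
    (fun n : ℕ => ENNReal.ofReal (10 * (1 / ((n:ℝ) + 1)))) (by
      have : Tendsto (fun n : ℕ => 10 * (1 / ((n:ℝ) + 1))) atTop (𝓝 (10 * 0)) :=
        tendsto_one_div_add_atTop_nhds_zero_nat.const_mul _
      have h2 := (ENNReal.continuous_ofReal.tendsto _).comp this
      rw [mul_zero, ENNReal.ofReal_zero] at h2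
      exact h2)
    (fun n t => Metric.closedBall (t:ℝ) (5 * e n t ^ (1 + β)))
    (Eventually.of_forall fun n t => by
      rw [hdiam]
      apply ENNReal.ofReal_le_ofReal
      obtain ⟨h1, h2⟩ := he n t t.2
      have h4 : (1:ℝ) / ((n:ℝ) + 1) ≤ 1 := by
        rw [div_le_one (by positivity)]; have : (0:ℝ) ≤ n := by positivity
        linarith
      have h3 : e n t ^ (1 + β) ≤ e n t ^ (1:ℝ) :=
        Real.rpow_le_rpow_of_exponent_ge h1 (h2.trans h4) (by linarith)
      rw [Real.rpow_one] at h3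
      linarith)
    (Eventually.of_forall fun n => hcov n)
  have hbound : ∀ n, ∑' t : u n, Metric.ediam (Metric.closedBall (t:ℝ) (5 * e n t ^ (1 + β))) ^ d
      ≤ ENNReal.ofReal (10 ^ d) * ENNReal.ofReal (b + 1 - a) := by
    intro n
    calc _ = ∑' t : u n, ENNReal.ofReal (10 ^ d) * ENNReal.ofReal (e n t) := by
          congr 1; ext t
          obtain ⟨h1, h2⟩ := he n t t.2
          rw [hdiam, ENNReal.ofReal_rpow_of_nonneg (by positivity) hd0.le,
            Real.mul_rpow (by norm_num) (by positivity), ← Real.rpow_mul h1.le, hd,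
            mul_one_div_cancel hb.ne', Real.rpow_one, ENNReal.ofReal_mul (by positivity)]
      _ = ENNReal.ofReal (10 ^ d) * ∑' t : u n, ENNReal.ofReal (e n t) := ENNReal.tsum_mul_left
      _ ≤ _ := by gcongr; exact hsum n
  have hfin : μH[d] T ≠ ⊤ := by
    have : μH[d] T ≤ ENNReal.ofReal (10 ^ d) * ENNReal.ofReal (b + 1 - a) := by
      refine hmain.trans ?_
      refine (liminf_le_liminf (Eventually.of_forall hbound)).trans ?_
      simp
    exact (this.trans_lt (ENNReal.mul_lt_top ENNReal.ofReal_lt_top ENNReal.ofReal_lt_top)).ne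
  have := dimH_le_of_hausdorffMeasure_ne_top (s := T) (d := d.toNNReal)
    (by rwa [Real.coe_toNNReal _ hd0.le])
  exact this

lemma left_gap_dim (β : ℝ) (hβ : 0 < β) (a b : ℝ) (T : Set ℝ) (hT : T ⊆ Set.Icc a b)
    (h : ∀ t ∈ T, ∀ η : ℝ, 0 < η → ∃ ε, 0 < ε ∧ ε ≤ η ∧
      ∀ s ∈ T, ¬ (t - ε < s ∧ s < t - ε ^ (1 + β))) :
    dimH T ≤ ENNReal.ofReal (1 / (1 + β)) := by
  have h1 := right_gap_dim β hβ (-b) (-a) ((fun x => -x) '' T) (by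
    rintro _ ⟨x, hx, rfl⟩
    have := hT hx
    exact ⟨by linarith [this.2], by linarith [this.1]⟩) (by
    rintro _ ⟨t, ht, rfl⟩ η hη
    obtain ⟨ε, h0, h1, h2⟩ := h t ht η hη
    refine ⟨ε, h0, h1, ?_⟩
    rintro _ ⟨s, hs, rfl⟩ ⟨h3, h4⟩
    exact h2 s hs ⟨by linarith, by linarith⟩)
  have h2 : dimH ((fun x : ℝ => -x) '' T) = dimH T :=
    (IsometryEquiv.neg ℝ).isometry.dimH_image T
  rwa [h2] at h1

lemma gap_dim (β : ℝ) (hβ : 0 < β) (a b : ℝ) (T : Set ℝ) (hT : T ⊆ Set.Icc a b)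
    (h : ∀ t ∈ T, ∀ η : ℝ, 0 < η → ∃ ε, 0 < ε ∧ ε ≤ η ∧
      ((∀ s ∈ T, ¬ (t - ε < s ∧ s < t - ε ^ (1 + β))) ∨
       (∀ s ∈ T, ¬ (t + ε ^ (1 + β) < s ∧ s < t + ε)))) :
    dimH T ≤ ENNReal.ofReal (1 / (1 + β)) := by
  set TR := {t ∈ T | ∀ η : ℝ, 0 < η → ∃ ε, 0 < ε ∧ ε ≤ η ∧
      ∀ s ∈ T, ¬ (t + ε ^ (1 + β) < s ∧ s < t + ε)} with hTR
  set TL := {t ∈ T | ∀ η : ℝ, 0 < η → ∃ ε, 0 < ε ∧ ε ≤ η ∧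
      ∀ s ∈ T, ¬ (t - ε < s ∧ s < t - ε ^ (1 + β))} with hTL
  have hsub : T ⊆ TR ∪ TL := by
    intro t ht
    by_cases h1 : t ∈ TR
    · exact Or.inl h1
    · right
      refine ⟨ht, fun η hη => ?_⟩
      have h2 : ¬ ∀ η : ℝ, 0 < η → ∃ ε, 0 < ε ∧ ε ≤ η ∧
        ∀ s ∈ T, ¬ (t + ε ^ (1 + β) < s ∧ s < t + ε) := fun h3 => h1 ⟨ht, h3⟩
      push Not at h2
      obtain ⟨η', h0, h3⟩ := h2
      obtain ⟨ε, h4, h5, h6⟩ := h t ht (min η η') (lt_min hη h0)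
      refine ⟨ε, h4, h5.trans (min_le_left _ _), ?_⟩
      rcases h6 with h6 | h6
      · exact h6
      · obtain ⟨s, hs, h7, h8⟩ := h3 ε h4 (h5.trans (min_le_right _ _))
        exact absurd ⟨h7, h8⟩ (h6 s hs)
  refine (dimH_mono hsub).trans ?_
  rw [dimH_union]
  refine max_le ?_ ?_
  · refine right_gap_dim β hβ a b TR ((Set.sep_subset _ _).trans hT) ?_
    rintro t ⟨ht, h1⟩ η hη
    obtain ⟨ε, h2, h3, h4⟩ := h1 η hη
    exact ⟨ε, h2, h3, fun s hs => h4 s hs.1⟩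
  · refine left_gap_dim β hβ a b TL ((Set.sep_subset _ _).trans hT) ?_
    rintro t ⟨ht, h1⟩ η hη
    obtain ⟨ε, h2, h3, h4⟩ := h1 η hη
    exact ⟨ε, h2, h3, fun s hs => h4 s hs.1⟩
open Filter Topology in
lemma analytic_primitive (f : ℝ → ℝ) (t0 : ℝ) (hf : AnalyticAt ℝ f t0) :
    ∃ s : ℝ → ℝ, AnalyticAt ℝ s t0 ∧ s t0 = 0 ∧ ∀ᶠ t in 𝓝 t0, HasDerivAt s (f t) t := by
  obtain ⟨p, hp⟩ := hf
  rw [hasFPowerSeriesAt_iff, Metric.eventually_nhds_iff] at hp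
  obtain ⟨r, hr, hp⟩ := hp
  set a : ℕ → ℝ := p.coeff with ha
  set R := r / 2 with hR
  have hR0 : 0 < R := by positivity
  have hu : Summable (fun n => R ^ n * |a n|) := by
    have h1 := (hp (y := R) (by simp [abs_of_pos hR0]; linarith)).summable.norm
    refine h1.congr fun n => ?_
    simp [abs_of_pos hR0]
  set g : ℕ → ℝ → ℝ := fun n z => z ^ (n + 1) / ((n:ℝ) + 1) * a n with hg
  have hder : ∀ n z, HasDerivAt (g n) (z ^ n * a n) z := by
    intro n z
    have h1 := ((hasDerivAt_pow (n+1) z).div_const ((n:ℝ)+1)).mul_const (a n)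
    have : (n:ℝ) + 1 ≠ 0 := by positivity
    have e1 : ((n + 1 : ℕ) : ℝ) * z ^ (n + 1 - 1) / ((n:ℝ) + 1) * a n = z ^ n * a n := by
      push_cast
      field_simp
    rw [e1] at h1
    exact h1
  have hbd : ∀ n, ∀ z ∈ Metric.ball (0:ℝ) R, ‖z ^ n * a n‖ ≤ R ^ n * |a n| := by
    intro n z hz
    simp only [Metric.mem_ball, dist_zero_right, Real.norm_eq_abs] at hz
    rw [norm_mul, norm_pow, Real.norm_eq_abs, Real.norm_eq_abs]
    gcongr
  have hsum0 : Summable (fun n => g n 0) := by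
    have : (fun n => g n 0) = fun n => 0 := by ext n; simp [hg]
    rw [this]; exact summable_zero
  have hD : ∀ z ∈ Metric.ball (0:ℝ) R, HasDerivAt (fun z => ∑' n, g n z) (f (t0 + z)) z := by
    intro z hz
    have h1 := hasDerivAt_tsum_of_isPreconnected hu Metric.isOpen_ball
      (convex_ball (0:ℝ) R).isPreconnected (fun n y _ => hder n y) hbd (Metric.mem_ball_self hR0)
      hsum0 hz
    have h2 := (hp (y := z) (by simp at hz ⊢; linarith)).tsum_eq
    simp only [smul_eq_mul] at h2
    rwa [h2] at h1
  refine ⟨fun t => ∑' n, g n (t - t0), ?_, ?_, ?_⟩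
  · refine ⟨FormalMultilinearSeries.ofScalars ℝ (fun n => Nat.casesOn n 0 (fun m => a m / ((m:ℝ)+1))), ?_⟩
    rw [hasFPowerSeriesAt_iff]
    filter_upwards [Metric.ball_mem_nhds (0:ℝ) hR0] with z hz
    rw [← hasSum_nat_add_iff' 1]
    simp only [FormalMultilinearSeries.coeff_ofScalars, add_sub_cancel_left]
    simp only [Finset.range_one, Finset.sum_singleton]
    have hs : Summable (fun n => g n z) := by
      refine Summable.of_norm_bounded (g := fun n => R * (R ^ n * |a n|)) (hu.mul_left R) ?_
      intro n
      have h1 := hbd n z hz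
      simp only [Metric.mem_ball, dist_zero_right, Real.norm_eq_abs] at hz
      have : g n z = z * (z ^ n * a n) / ((n:ℝ) + 1) := by simp only [hg]; ring
      rw [this, norm_div, norm_mul]
      have h3 : (1:ℝ) ≤ ‖(n:ℝ)+1‖ := by
        rw [Real.norm_eq_abs, abs_of_nonneg (by positivity)]
        have : (0:ℝ) ≤ n := by positivity
        linarith
      refine (div_le_self (by positivity) h3).trans ?_
      rw [Real.norm_eq_abs z]
      gcongr
    have e1 : (fun n : ℕ => z ^ (n + 1) • (a n / ((n:ℝ) + 1))) = fun n => g n z := by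
      ext n
      simp only [hg, smul_eq_mul]
      ring
    have e2 : HasSum (fun n : ℕ => z ^ (n + 1) • (a n / ((n:ℝ) + 1))) (∑' n, g n z) := by
      rw [e1]; exact hs.hasSum
    simpa using e2
  · simp [hg]
  · filter_upwards [Metric.ball_mem_nhds t0 hR0] with t ht
    have h1 := (hD (t - t0) (by simpa [dist_eq_norm] using ht)).comp t ((hasDerivAt_id t).sub_const t0)
    simpa [Function.comp_def] using h1

open Filter Topology in
lemma arclength (σ : ℝ → E3) (t0 : ℝ) (hσ : AnalyticAt ℝ σ t0) (hd : deriv σ t0 ≠ 0) :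
    ∃ (δ : ℝ) (φ : ℝ → ℝ), 0 < δ ∧ φ 0 = t0 ∧
      AnalyticOnNhd ℝ (σ ∘ φ) (Set.Ioo (-δ) δ) ∧
      (∀ t ∈ Set.Ioo (-δ) δ, ‖deriv (σ ∘ φ) t‖ = 1) ∧
      ∀ᶠ t in 𝓝 t0, ∃ x ∈ Set.Ioo (-δ) δ, φ x = t := by
  have hw : AnalyticAt ℝ (fun t => ‖deriv σ t‖) t0 := by
    have h1 : ContDiffAt ℝ ⊤ (deriv σ) t0 := hσ.deriv.contDiffAt
    have := h1.norm ℝ hd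
    exact this.analyticAt
  obtain ⟨s, hs, hs0, hsd⟩ := analytic_primitive _ t0 hw
  have hne : deriv s t0 ≠ 0 := by
    rw [hsd.self_of_nhds.deriv]; simpa using hd
  set φ := hs.hasStrictDerivAt.localInverse _ _ _ hne with hφ
  have hφa : AnalyticAt ℝ φ (s t0) := hs.analyticAt_localInverse hne
  have hφ0 : φ (s t0) = t0 := HasStrictFDerivAt.localInverse_apply_image ..
  have hri : ∀ᶠ x in 𝓝 (s t0), s (φ x) = x := HasStrictDerivAt.eventually_right_inverse ..
  have hli : ∀ᶠ t in 𝓝 t0, φ (s t) = t := HasStrictDerivAt.eventually_left_inverse ..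
  rw [hs0] at hφa hφ0 hri
  have hφc : Tendsto φ (𝓝 0) (𝓝 t0) := by
    have := hφa.continuousAt.tendsto
    rwa [hφ0] at this
  have hcomp : AnalyticAt ℝ (σ ∘ φ) 0 := by
    apply AnalyticAt.comp _ hφa
    rwa [hφ0]
  have hdn : ∀ᶠ t in 𝓝 t0, deriv σ t ≠ 0 :=
    hσ.deriv.continuousAt.eventually_ne hd
  have hev : ∀ᶠ x in 𝓝 (0:ℝ), AnalyticAt ℝ (σ ∘ φ) x ∧ ‖deriv (σ ∘ φ) x‖ = 1 := by
    filter_upwards [hcomp.eventually_analyticAt, hφa.eventually_analyticAt, hri.eventually_nhds,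
      hφc.eventually hsd, hφc.eventually hσ.eventually_analyticAt, hφc.eventually hdn] with
      x h1 h2 h3 h4 h5 h6
    refine ⟨h1, ?_⟩
    have h7 : HasDerivAt (s ∘ φ) (‖deriv σ (φ x)‖ * deriv φ x) x :=
      h4.comp x h2.differentiableAt.hasDerivAt
    have h8 : HasDerivAt (s ∘ φ) 1 x :=
      (hasDerivAt_id x).congr_of_eventuallyEq (h3.mono fun y hy => hy)
    have h9 := h7.unique h8
    have h10 : HasDerivAt (σ ∘ φ) (deriv φ x • deriv σ (φ x)) x :=
      HasDerivAt.scomp x h5.differentiableAt.hasDerivAt h2.differentiableAt.hasDerivAt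
    rw [h10.deriv, norm_smul, Real.norm_eq_abs]
    have h11 : 0 < ‖deriv σ (φ x)‖ := norm_pos_iff.2 h6
    have h12 : 0 < deriv φ x := by
      by_contra hc
      push Not at hc
      nlinarith
    rw [abs_of_pos h12]; linarith
  obtain ⟨δ, hδ, hball⟩ := Metric.eventually_nhds_iff.1 hev
  have hmem : ∀ x ∈ Set.Ioo (-δ) δ, dist x 0 < δ := by
    intro x hx; simpa [abs_lt] using hx
  refine ⟨δ, φ, hδ, hφ0, fun x hx => (hball (hmem x hx)).1, fun x hx => (hball (hmem x hx)).2, ?_⟩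
  have hsc : Tendsto s (𝓝 t0) (𝓝 0) := by
    have := hs.continuousAt.tendsto
    rwa [hs0] at this
  filter_upwards [hli, hsc.eventually (Ioo_mem_nhds (neg_lt_zero.2 hδ) hδ)] with t h1 h2
  exact ⟨s t, h2, h1⟩
open Filter Topology in
lemma curve_dim (M : Set E3) (β : ℝ) (hβ : 0 < β)
    (hno : ¬ ∃ (p : E3) (δ : ℝ) (γ : ℝ → E3),
        p ∈ M ∧ 0 < δ ∧ γ 0 = p ∧
        AnalyticOnNhd ℝ γ (Set.Ioo (-δ) δ) ∧
        (∀ t ∈ Set.Ioo (-δ) δ, γ t ∈ Sphere2) ∧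
        (∀ t ∈ Set.Ioo (-δ) δ, ‖deriv γ t‖ = 1) ∧
        UniformTwoSidedAcc M β δ γ)
    (σ : ℝ → E3) (t0 : ℝ) (hσ : AnalyticAt ℝ σ t0) (hd : deriv σ t0 ≠ 0)
    (hS : ∀ t, σ t ∈ Sphere2) :
    ∃ V ∈ 𝓝 t0, dimH (M ∩ σ '' V) ≤ ENNReal.ofReal (1 / (1 + β)) := by
  obtain ⟨δ, φ, hδ, hφ0, han, hsp, hcov⟩ := arclength σ t0 hσ hd
  refine ⟨_, hcov, ?_⟩
  set γ := σ ∘ φ with hγ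
  set T := {t ∈ Set.Ioo (-δ) δ | γ t ∈ M} with hT
  have hsub : M ∩ σ '' {t | ∃ x ∈ Set.Ioo (-δ) δ, φ x = t} ⊆ γ '' T := by
    rintro _ ⟨hM, t, ⟨x, hx, rfl⟩, rfl⟩
    exact ⟨x, ⟨hx, hM⟩, rfl⟩
  have hcd : ContDiffOn ℝ 1 γ (Set.Ioo (-δ) δ) := fun x hx =>
    (han x hx).contDiffAt.contDiffWithinAt
  refine (dimH_mono hsub).trans ((hcd.dimH_image_le (convex_Ioo _ _) (Set.sep_subset _ _)).trans ?_)
  refine gap_dim β hβ (-δ) δ T (fun t ht => Set.Ioo_subset_Icc_self ht.1) ?_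
  rintro t ⟨ht, htM⟩ η hη
  set δ' := δ - |t| with hδ'
  have htabs : |t| < δ := abs_lt.2 ht
  have hδ'0 : 0 < δ' := by simp only [hδ']; linarith
  have hin : ∀ x ∈ Set.Ioo (-δ') δ', t + x ∈ Set.Ioo (-δ) δ := by
    intro x hx
    rw [Set.mem_Ioo, ← abs_lt] at hx ⊢
    have := abs_add_le t x
    simp only [hδ'] at hx
    linarith
  have hnU : ¬ UniformTwoSidedAcc M β δ' (fun x => γ (t + x)) := by
    intro hU
    refine hno ⟨γ t, δ', fun x => γ (t + x), htM, hδ'0, by simp, ?_, ?_, ?_, hU⟩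
    · intro x hx
      have h1 : AnalyticAt ℝ (fun x : ℝ => t + x) x := analyticAt_const.add analyticAt_id
      exact AnalyticAt.comp (g := γ) (han _ (hin x hx)) h1
    · intro x hx
      exact hS _
    · intro x hx
      have h1 : deriv (fun x => γ (t + x)) x = deriv γ (t + x) := deriv_comp_const_add γ t x
      rw [h1]
      exact hsp _ (hin x hx)
  unfold UniformTwoSidedAcc at hnU
  push Not at hnU
  obtain ⟨ε, h0, h1, h2⟩ := hnU (min η (δ' / 2)) (by positivity)
    (lt_of_le_of_lt (min_le_right _ _) (by linarith))
  refine ⟨ε, h0, h1.trans (min_le_left _ _), ?_⟩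
  by_cases hL : ∃ x ∈ Set.Ioo (-ε) (-(ε ^ (1 + β))), γ (t + x) ∈ M
  · right
    rintro s ⟨hs, hsM⟩ ⟨h3, h4⟩
    refine h2 hL (s - t) ⟨by linarith, by linarith⟩ ?_
    simpa using hsM
  · left
    rintro s ⟨hs, hsM⟩ ⟨h3, h4⟩
    refine hL ⟨s - t, ⟨by linarith, by linarith⟩, ?_⟩
    simpa using hsM
/-- Inverse stereographic projection. -/
noncomputable def stereoF (z : ℝ × ℝ) : E3 :=
  mkE3 (2 * z.1 / (1 + z.1 ^ 2 + z.2 ^ 2)) (2 * z.2 / (1 + z.1 ^ 2 + z.2 ^ 2))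
    ((z.1 ^ 2 + z.2 ^ 2 - 1) / (1 + z.1 ^ 2 + z.2 ^ 2))

lemma mkE3_0 (a b c : ℝ) : mkE3 a b c 0 = a := rfl
lemma mkE3_1 (a b c : ℝ) : mkE3 a b c 1 = b := rfl
lemma mkE3_2 (a b c : ℝ) : mkE3 a b c 2 = c := rfl

lemma mem_Sphere2_iff (x : E3) : x ∈ Sphere2 ↔ x 0 ^ 2 + x 1 ^ 2 + x 2 ^ 2 = 1 := by
  unfold Sphere2
  rw [mem_sphere_zero_iff_norm, EuclideanSpace.norm_eq, Real.sqrt_eq_one]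
  simp [Fin.sum_univ_three]

lemma stereoF_mem (z : ℝ × ℝ) : stereoF z ∈ Sphere2 := by
  rw [mem_Sphere2_iff]
  simp only [stereoF, mkE3_0, mkE3_1, mkE3_2]
  have : 1 + z.1 ^ 2 + z.2 ^ 2 ≠ 0 := by positivity
  field_simp
  ring

lemma stereoF_surj (x : E3) (hx : x ∈ Sphere2) (h2 : x 2 ≠ 1) : ∃ z, stereoF z = x := by
  rw [mem_Sphere2_iff] at hx
  have h1 : 1 - x 2 ≠ 0 := fun h => h2 (by linarith)
  refine ⟨(x 0 / (1 - x 2), x 1 / (1 - x 2)), ?_⟩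
  have hq : 1 + (x 0 / (1 - x 2)) ^ 2 + (x 1 / (1 - x 2)) ^ 2 = 2 / (1 - x 2) := by
    field_simp
    nlinarith
  have hq2 : (x 0 / (1 - x 2)) ^ 2 + (x 1 / (1 - x 2)) ^ 2 - 1 = 2 / (1 - x 2) - 2 := by
    linarith
  ext i
  fin_cases i
  · change 2 * (x 0 / (1 - x 2)) / _ = x 0
    simp only
    rw [hq]; field_simp
  · change 2 * (x 1 / (1 - x 2)) / _ = x 1
    simp only
    rw [hq]; field_simp
  · change (_ - 1) / _ = x 2
    simp only
    rw [hq, hq2]; field_simp; ring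

open Filter Topology in
lemma planar_curve_dim (M : Set E3) (β : ℝ) (hβ : 0 < β)
    (hno : ¬ ∃ (p : E3) (δ : ℝ) (γ : ℝ → E3),
        p ∈ M ∧ 0 < δ ∧ γ 0 = p ∧
        AnalyticOnNhd ℝ γ (Set.Ioo (-δ) δ) ∧
        (∀ t ∈ Set.Ioo (-δ) δ, γ t ∈ Sphere2) ∧
        (∀ t ∈ Set.Ioo (-δ) δ, ‖deriv γ t‖ = 1) ∧
        UniformTwoSidedAcc M β δ γ)
    (a b : ℝ → ℝ) (t0 : ℝ) (ha : ContDiffAt ℝ ⊤ a t0) (hb : ContDiffAt ℝ ⊤ b t0)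
    (hd : deriv a t0 ≠ 0 ∨ deriv b t0 ≠ 0) :
    ∃ V ∈ 𝓝 t0, dimH (M ∩ (fun t => stereoF (a t, b t)) '' V) ≤ ENNReal.ofReal (1 / (1 + β)) := by
  have hcd : ContDiffAt ℝ ⊤ (fun t => stereoF (a t, b t)) t0 := by
    rw [contDiffAt_euclidean]
    have hq : ContDiffAt ℝ ⊤ (fun t => 1 + a t ^ 2 + b t ^ 2) t0 := by fun_prop
    have hq0 : 1 + a t0 ^ 2 + b t0 ^ 2 ≠ 0 := by positivity
    intro i
    fin_cases i
    · exact ContDiffAt.div (f := fun t => 2 * a t) (by fun_prop) hq hq0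
    · exact ContDiffAt.div (f := fun t => 2 * b t) (by fun_prop) hq hq0
    · exact ContDiffAt.div (f := fun t => a t ^ 2 + b t ^ 2 - 1) (by fun_prop) hq hq0
  refine curve_dim M β hβ hno _ t0 hcd.analyticAt ?_ (fun t => stereoF_mem _)
  intro h0
  have hD : HasDerivAt (fun t => stereoF (a t, b t)) 0 t0 := by
    have := (hcd.differentiableAt (by simp)).hasDerivAt
    rwa [h0] at this
  have hi : ∀ i, HasDerivAt (fun t => stereoF (a t, b t) i) 0 t0 := by
    intro i
    have := (EuclideanSpace.proj (𝕜 := ℝ) i).hasFDerivAt.comp_hasDerivAt t0 hD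
    simpa [Function.comp_def] using this
  have h1 : ∀ t, 1 - stereoF (a t, b t) 2 = 2 / (1 + a t ^ 2 + b t ^ 2) := by
    intro t
    simp only [stereoF, mkE3_2]
    have : 1 + a t ^ 2 + b t ^ 2 ≠ 0 := by positivity
    field_simp; ring
  have hne : 1 - stereoF (a t0, b t0) 2 ≠ 0 := by
    rw [h1]; positivity
  have hA : HasDerivAt a 0 t0 := by
    have h2 : HasDerivAt (fun t => stereoF (a t, b t) 0 / (1 - stereoF (a t, b t) 2)) 0 t0 := by
      have h4 := (hi 0).fun_div ((hi 2).const_sub 1) hne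
      have h5 : (0 * (1 - stereoF (a t0, b t0) 2) - stereoF (a t0, b t0) 0 * -0) /
          (1 - stereoF (a t0, b t0) 2) ^ 2 = 0 := by simp
      rwa [h5] at h4
    have h3 : a = fun t => stereoF (a t, b t) 0 / (1 - stereoF (a t, b t) 2) := by
      ext t
      rw [h1]
      simp only [stereoF, mkE3_0]
      have : 1 + a t ^ 2 + b t ^ 2 ≠ 0 := by positivity
      field_simp
    rw [h3]
    exact h2
  have hB : HasDerivAt b 0 t0 := by
    have h2 : HasDerivAt (fun t => stereoF (a t, b t) 1 / (1 - stereoF (a t, b t) 2)) 0 t0 := by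
      have h4 := (hi 1).fun_div ((hi 2).const_sub 1) hne
      have h5 : (0 * (1 - stereoF (a t0, b t0) 2) - stereoF (a t0, b t0) 1 * -0) /
          (1 - stereoF (a t0, b t0) 2) ^ 2 = 0 := by simp
      rwa [h5] at h4
    have h3 : b = fun t => stereoF (a t, b t) 1 / (1 - stereoF (a t, b t) 2) := by
      ext t
      rw [h1]
      simp only [stereoF, mkE3_1]
      have : 1 + a t ^ 2 + b t ^ 2 ≠ 0 := by positivity
      field_simp
    rw [h3]
    exact h2
  rcases hd with h | h
  · exact h hA.deriv
  · exact h hB.deriv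

open Filter Topology in
lemma plane_local (M : Set E3) (d : ℝ≥0∞) (A : Set (ℝ × ℝ))
    (h : ∀ z ∈ A, ∃ W ∈ 𝓝[A] z, dimH (M ∩ stereoF '' W) ≤ d) : dimH (M ∩ stereoF '' A) ≤ d := by
  choose! W hW hd using h
  obtain ⟨t, htA, htc, hcov⟩ := TopologicalSpace.countable_cover_nhdsWithin hW
  have : M ∩ stereoF '' A ⊆ ⋃ z ∈ t, M ∩ stereoF '' W z := by
    rintro _ ⟨hM, z, hz, rfl⟩
    have := hcov hz
    simp only [Set.mem_iUnion] at this ⊢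
    obtain ⟨w, hw, hzw⟩ := this
    exact ⟨w, hw, hM, z, hzw, rfl⟩
  refine (dimH_mono this).trans ?_
  rw [dimH_bUnion htc]
  exact iSup₂_le fun z hz => hd z (htA hz)

open Polynomial in
lemma evalEval_contDiff (Q : ℝ[X][X]) : ContDiff ℝ ⊤ (fun z : ℝ × ℝ => Q.evalEval z.1 z.2) := by
  have : (fun z : ℝ × ℝ => Q.evalEval z.1 z.2) =
      fun z => ∑ i ∈ Finset.range (Q.natDegree + 1), (Q.coeff i).eval z.1 * z.2 ^ i := by
    ext z
    rw [Polynomial.evalEval, Polynomial.eval_eq_sum_range (p := Q), Polynomial.eval_finsetSum]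
    refine Finset.sum_congr rfl fun i _ => ?_
    rw [Polynomial.eval_mul, Polynomial.eval_pow, Polynomial.eval_C]
  rw [this]
  refine ContDiff.sum fun i _ => ?_
  have h1 : ContDiff ℝ ⊤ (fun x : ℝ => (Q.coeff i).eval x) := by
    simpa [Polynomial.coe_aeval_eq_eval] using Polynomial.contDiff_aeval (𝕜 := ℝ) (Q.coeff i) ⊤
  exact (h1.comp contDiff_fst).mul (contDiff_snd.pow i)

open Polynomial in
lemma evalEval_hasDerivAt (Q : ℝ[X][X]) (u v : ℝ) :
    HasDerivAt (fun y => Q.evalEval u y) ((derivative Q).evalEval u v) v := by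
  have h : ∀ (P : ℝ[X][X]) y, P.evalEval u y = (P.map (evalRingHom u)).eval y := by
    intro P y
    rw [map_evalRingHom_eval]
  simp_rw [h]
  rw [← derivative_map]
  exact Polynomial.hasDerivAt _ v

open Filter Topology Polynomial in
lemma zero_set_dim (M : Set E3) (β : ℝ) (hβ : 0 < β)
    (hno : ¬ ∃ (p : E3) (δ : ℝ) (γ : ℝ → E3),
        p ∈ M ∧ 0 < δ ∧ γ 0 = p ∧
        AnalyticOnNhd ℝ γ (Set.Ioo (-δ) δ) ∧
        (∀ t ∈ Set.Ioo (-δ) δ, γ t ∈ Sphere2) ∧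
        (∀ t ∈ Set.Ioo (-δ) δ, ‖deriv γ t‖ = 1) ∧
        UniformTwoSidedAcc M β δ γ) (n : ℕ) :
    ∀ Q : ℝ[X][X], Q ≠ 0 → Q.natDegree ≤ n →
      dimH (M ∩ stereoF '' {z | Q.evalEval z.1 z.2 = 0}) ≤ ENNReal.ofReal (1 / (1 + β)) := by
  induction n with
  | zero =>
    intro Q hQ hn
    rw [Nat.le_zero, natDegree_eq_zero] at hn
    obtain ⟨q, rfl⟩ := hn
    have hq : q ≠ 0 := fun h => hQ (by simp [h])
    apply plane_local
    rintro ⟨u, v⟩ hz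
    simp only [Set.mem_setOf_eq, evalEval_C] at hz
    obtain ⟨V, hV, hdim⟩ := planar_curve_dim M β hβ hno (fun _ => u) (fun t => t) v
      contDiffAt_const contDiffAt_id (Or.inr (by simp))
    have hfin : ∀ᶠ x in 𝓝 u, q.eval x = 0 → x = u := by
      have h1 : ({x | q.IsRoot x} \ {u}).Finite := (q.finite_setOf_isRoot hq).subset Set.diff_subset
      have h2 := h1.isClosed.isOpen_compl.mem_nhds (x := u) (by simp)
      filter_upwards [h2] with x hx h3
      by_contra hne
      exact hx ⟨h3, hne⟩
    refine ⟨{z | (C q).evalEval z.1 z.2 = 0} ∩ {z | (q.eval z.1 = 0 → z.1 = u) ∧ z.2 ∈ V}, ?_, ?_⟩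
    · refine inter_mem self_mem_nhdsWithin (mem_nhdsWithin_of_mem_nhds ?_)
      rw [nhds_prod_eq]
      exact prod_mem_prod hfin hV
    · refine (dimH_mono ?_).trans hdim
      rintro _ ⟨hM, ⟨x, y⟩, ⟨h1, h2, h3⟩, rfl⟩
      simp only [Set.mem_setOf_eq, evalEval_C] at h1 h2 h3
      refine ⟨hM, y, h3, ?_⟩
      simp [h2 h1]
  | succ n ih =>
    intro Q hQ hn
    by_cases hdeg : Q.natDegree = 0
    · exact ih Q hQ (by omega)
    have hlt := natDegree_derivative_lt hdeg
    have hne : derivative Q ≠ 0 := fun h => hdeg (natDegree_eq_zero_of_derivative_eq_zero h)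
    have hsub : M ∩ stereoF '' {z | Q.evalEval z.1 z.2 = 0} ⊆
        (M ∩ stereoF '' {z | Q.evalEval z.1 z.2 = 0 ∧ (derivative Q).evalEval z.1 z.2 ≠ 0}) ∪
        (M ∩ stereoF '' {z | (derivative Q).evalEval z.1 z.2 = 0}) := by
      rintro _ ⟨hM, z, hz, rfl⟩
      by_cases h : (derivative Q).evalEval z.1 z.2 = 0
      · exact Or.inr ⟨hM, z, h, rfl⟩
      · exact Or.inl ⟨hM, z, ⟨hz, h⟩, rfl⟩
    refine (dimH_mono hsub).trans ?_
    rw [dimH_union]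
    refine max_le ?_ (ih _ hne (by omega))
    apply plane_local
    rintro z ⟨hz, hdz⟩
    have hcd : ContDiffAt ℝ ⊤ (fun z : ℝ × ℝ => Q.evalEval z.1 z.2) z := (evalEval_contDiff Q).contDiffAt
    have hinv : (fderiv ℝ (fun z : ℝ × ℝ => Q.evalEval z.1 z.2) z ∘L .inr ℝ ℝ ℝ).IsInvertible := by
      have h1 : HasDerivAt (fun y : ℝ => (z.1, y)) ((0:ℝ), (1:ℝ)) z.2 :=
        (hasDerivAt_const z.2 z.1).prodMk (hasDerivAt_id z.2)
      have h2 : HasFDerivAt (fun z : ℝ × ℝ => Q.evalEval z.1 z.2)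
        (fderiv ℝ (fun z : ℝ × ℝ => Q.evalEval z.1 z.2) z) (z.1, z.2) :=
        (hcd.differentiableAt (by simp)).hasFDerivAt
      have h3 := (h2.comp_hasDerivAt z.2 h1).unique (evalEval_hasDerivAt Q z.1 z.2)
      refine ⟨ContinuousLinearEquiv.unitsEquivAut ℝ (Units.mk0 _ hdz), ?_⟩
      ext
      simp [h3]
    set ψ := hcd.implicitFunction (by simp) hinv with hψ
    have hψc : ContDiffAt ℝ ⊤ ψ z.1 := hcd.contDiffAt_implicitFunction (by simp) hinv
    have hev : ∀ᶠ v in 𝓝 z, Q.evalEval v.1 v.2 = Q.evalEval z.1 z.2 ↔ ψ v.1 = v.2 :=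
      hcd.eventually_apply_eq_iff_implicitFunction (by simp) hinv
    obtain ⟨V, hV, hdim⟩ := planar_curve_dim M β hβ hno (fun t => t) ψ z.1
      contDiffAt_id hψc (Or.inl (by simp))
    refine ⟨{z | Q.evalEval z.1 z.2 = 0 ∧ (derivative Q).evalEval z.1 z.2 ≠ 0} ∩
      ({v | Q.evalEval v.1 v.2 = Q.evalEval z.1 z.2 ↔ ψ v.1 = v.2} ∩ Prod.fst ⁻¹' V), ?_, ?_⟩
    · exact inter_mem self_mem_nhdsWithin (mem_nhdsWithin_of_mem_nhds
        (inter_mem hev (continuous_fst.continuousAt.preimage_mem_nhds hV)))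
    · refine (dimH_mono ?_).trans hdim
      rintro _ ⟨hM, v, ⟨⟨h1, _⟩, h2, h3⟩, rfl⟩
      refine ⟨hM, v.1, h3, ?_⟩
      have h4 := h2.1 (h1.trans hz.symm)
      simp [h4]
lemma Lfun_cont (τ : ℝ) : Continuous (fun z : E3 × E3 => Lfun τ z.1 z.2) := by
  unfold Lfun Dfun
  fun_prop

lemma Lfun_nonneg (τ : ℝ) (x y : E3) : 0 ≤ Lfun τ x y := le_max_left _ _

lemma Lfun_bound (τ : ℝ) (x y : E3) (hx : x ∈ Sphere2) (hy : y ∈ Sphere2) :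
    |Lfun τ x y| ≤ 1 + τ ^ 2 := by
  rw [abs_of_nonneg (Lfun_nonneg _ _ _)]
  have h := abs_real_inner_le_norm x y
  have h1 : ‖x‖ = 1 := by simpa [Sphere2] using hx
  have h2 : ‖y‖ = 1 := by simpa [Sphere2] using hy
  rw [h1, h2, mul_one, abs_le] at h
  unfold Lfun Dfun
  apply max_le (by positivity)
  obtain ⟨h3, h4⟩ := h
  have h5 : 0 ≤ τ ^ 2 * (1 - ⟪x, y⟫) := by
    apply mul_nonneg (sq_nonneg _); linarith
  have h6 : (1 + ⟪x, y⟫) * (2 - τ ^ 2 * (1 - ⟪x, y⟫)) ≤ (1 + ⟪x, y⟫) * 2 := by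
    apply mul_le_mul_of_nonneg_left <;> linarith
  nlinarith [sq_nonneg τ]

lemma sphere_ae (ρ : Measure E3) (h : ρ Sphere2ᶜ = 0) : ∀ᵐ x ∂ρ, x ∈ Sphere2 := h

lemma L_integrable (τ : ℝ) (ρ : Measure E3) [IsProbabilityMeasure ρ] (h : ρ Sphere2ᶜ = 0)
    (f g : E3 → ℝ) (hf : Measurable f) (hg : Measurable g) (C : ℝ)
    (hfC : ∀ x, |f x| ≤ C) (hgC : ∀ x, |g x| ≤ C) :
    Integrable (fun z : E3 × E3 => Lfun τ z.1 z.2 * f z.1 * g z.2) (ρ.prod ρ) := by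
  have hC : 0 ≤ C := (abs_nonneg _).trans (hfC 0)
  have hS : ∀ᵐ z ∂(ρ.prod ρ), z.1 ∈ Sphere2 ∧ z.2 ∈ Sphere2 := by
    have h1 : ∀ᵐ z ∂(ρ.prod ρ), z.1 ∈ Sphere2 :=
      Measure.quasiMeasurePreserving_fst.ae (sphere_ae ρ h)
    have h2 : ∀ᵐ z ∂(ρ.prod ρ), z.2 ∈ Sphere2 :=
      Measure.quasiMeasurePreserving_snd.ae (sphere_ae ρ h)
    exact h1.and h2
  refine Integrable.of_bound (C := (1 + τ ^ 2) * C * C) ?_ ?_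
  · exact (((Lfun_cont τ).measurable.mul (hf.comp measurable_fst)).mul
      (hg.comp measurable_snd)).aestronglyMeasurable
  · filter_upwards [hS] with z hz
    rw [Real.norm_eq_abs, abs_mul, abs_mul]
    gcongr
    · exact Lfun_bound τ _ _ hz.1 hz.2
    · exact hfC _
    · exact hgC _

lemma action_withDensity (τ : ℝ) (ρ : Measure E3) [IsProbabilityMeasure ρ] (h : ρ Sphere2ᶜ = 0)
    (d : E3 → ℝ) (hd : Measurable d) (C : ℝ) (hdC : ∀ x, |d x| ≤ C) (hd0 : ∀ x, 0 ≤ d x) :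
    causalAction τ (ρ.withDensity (fun x => ENNReal.ofReal (d x))) =
      ∫ z, Lfun τ z.1 z.2 * d z.1 * d z.2 ∂(ρ.prod ρ) := by
  have hm : Measurable (fun x => ENNReal.ofReal (d x)) := hd.ennreal_ofReal
  have hlt : ∀ᵐ x ∂ρ, ENNReal.ofReal (d x) < ∞ := by simp
  rw [integral_prod _ (L_integrable τ ρ h d d hd hd C hdC hdC)]
  unfold causalAction
  rw [integral_withDensity_eq_integral_toReal_smul hm hlt]
  refine integral_congr_ae (Filter.Eventually.of_forall fun x => ?_)
  simp only
  rw [integral_withDensity_eq_integral_toReal_smul hm hlt, smul_eq_mul, ← integral_const_mul]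
  refine integral_congr_ae (Filter.Eventually.of_forall fun y => ?_)
  simp only [smul_eq_mul, ENNReal.toReal_ofReal (hd0 _)]
  ring

lemma pert_ineq (τ : ℝ) (ρ : Measure E3) (hmin : IsMinimizer τ ρ) (ψ : E3 → ℝ)
    (hψ : Measurable ψ) (hb : ∀ x, |ψ x| ≤ 1 / 2) :
    (1 + ∫ x, ψ x ∂ρ) ^ 2 * causalAction τ ρ ≤ causalAction τ ρ +
      ((∫ z, Lfun τ z.1 z.2 * ψ z.1 * 1 ∂(ρ.prod ρ)) +
       ∫ z, Lfun τ z.1 z.2 * 1 * ψ z.2 ∂(ρ.prod ρ)) +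
      ∫ z, Lfun τ z.1 z.2 * ψ z.1 * ψ z.2 ∂(ρ.prod ρ) := by
  obtain ⟨hp, hr, h0, hm⟩ := hmin
  have hψi : Integrable ψ ρ := Integrable.of_bound (C := 1 / 2) hψ.aestronglyMeasurable
    (Filter.Eventually.of_forall hb)
  set c := ∫ x, ψ x ∂ρ with hc
  have hcb : |c| ≤ 1 / 2 := by
    have := norm_integral_le_of_norm_le_const (μ := ρ) (f := ψ) (C := 1 / 2)
      (Filter.Eventually.of_forall hb)
    simpa using this
  have hc1 : 1 / 2 ≤ 1 + c := by linarith [(abs_le.1 hcb).1]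
  have hc0 : 0 < 1 + c := by linarith
  set d : E3 → ℝ := fun x => (1 + ψ x) / (1 + c) with hd
  have hdm : Measurable d := (measurable_const.add hψ).div_const _
  have hd0 : ∀ x, 0 ≤ d x := fun x => div_nonneg (by linarith [(abs_le.1 (hb x)).1]) hc0.le
  have hdC : ∀ x, |d x| ≤ 3 := fun x => by
    rw [abs_of_nonneg (hd0 x), hd]
    simp only
    rw [div_le_iff₀ hc0]
    linarith [(abs_le.1 (hb x)).2]
  have hdi : Integrable d ρ := ((integrable_const _).add hψi).div_const _
  have hd1 : ∫ x, d x ∂ρ = 1 := by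
    simp only [hd]
    rw [integral_div, integral_add (integrable_const _) hψi, ← hc]
    simp
    exact hc0.ne'
  have key := hm (ρ.withDensity (fun x => ENNReal.ofReal (d x))) ?_ ?_ ?_
  · rw [action_withDensity τ ρ h0 d hdm 3 hdC hd0] at key
    have i1 := L_integrable τ ρ h0 1 1 measurable_one measurable_one 1 (by simp) (by simp)
    have hb1 : ∀ x, |ψ x| ≤ 1 := fun x => (hb x).trans (by norm_num)
    have i2 := L_integrable τ ρ h0 ψ 1 hψ measurable_one 1 hb1 (by simp)
    have i3 := L_integrable τ ρ h0 1 ψ measurable_one hψ 1 (by simp) hb1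
    have i4 := L_integrable τ ρ h0 ψ ψ hψ hψ 1 hb1 hb1
    simp only [Pi.one_apply] at i1 i2 i3
    have hS : causalAction τ ρ = ∫ z, Lfun τ z.1 z.2 * 1 * 1 ∂(ρ.prod ρ) := by
      rw [integral_prod _ i1]
      simp [causalAction]
    have hE : ∫ z, Lfun τ z.1 z.2 * d z.1 * d z.2 ∂(ρ.prod ρ) = (1 / (1 + c) ^ 2) *
        ((∫ z, Lfun τ z.1 z.2 * 1 * 1 ∂(ρ.prod ρ)) +
      ((∫ z, Lfun τ z.1 z.2 * ψ z.1 * 1 ∂(ρ.prod ρ)) +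
       ∫ z, Lfun τ z.1 z.2 * 1 * ψ z.2 ∂(ρ.prod ρ)) +
      ∫ z, Lfun τ z.1 z.2 * ψ z.1 * ψ z.2 ∂(ρ.prod ρ)) := by
      rw [← integral_add i2 i3, ← integral_add i1 (i2.fun_add i3), ← integral_add (i1.fun_add (i2.fun_add i3)) i4,
        ← integral_const_mul]
      refine integral_congr_ae (Filter.Eventually.of_forall fun z => ?_)
      simp only [hd, Pi.add_apply]
      field_simp
      ring
    rw [hE, ← hS] at key
    have := mul_le_mul_of_nonneg_left key (sq_nonneg (1 + c))
    refine this.trans (le_of_eq ?_)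
    rw [← mul_assoc, mul_one_div_cancel (by positivity), one_mul]
  · refine ⟨?_⟩
    rw [withDensity_apply _ MeasurableSet.univ, Measure.restrict_univ,
      ← ofReal_integral_eq_lintegral_ofReal hdi (Filter.Eventually.of_forall hd0), hd1]
    simp
  · have : IsFiniteMeasure (ρ.withDensity (fun x => ENNReal.ofReal (d x))) :=
      isFiniteMeasure_withDensity_ofReal hdi.2
    infer_instance
  · exact withDensity_absolutelyContinuous _ _ h0

lemma L_pos_half (τ : ℝ) (ρ : Measure E3) (hmin : IsMinimizer τ ρ) (ψ : E3 → ℝ)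
    (hψ : Measurable ψ) (hb : ∀ x, |ψ x| ≤ 1 / 2) :
    0 ≤ ∫ z, Lfun τ z.1 z.2 * ψ z.1 * ψ z.2 ∂(ρ.prod ρ) := by
  have h1 := pert_ineq τ ρ hmin ψ hψ hb
  have h2 := pert_ineq τ ρ hmin (fun x => - ψ x) hψ.neg (by simpa using hb)
  have hS : 0 ≤ causalAction τ ρ :=
    integral_nonneg fun x => integral_nonneg fun y => Lfun_nonneg _ _ _
  simp only [mul_neg, neg_mul, neg_neg, integral_neg] at h2
  nlinarith [mul_nonneg (sq_nonneg (∫ x, ψ x ∂ρ)) hS]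

lemma L_pos (τ : ℝ) (ρ : Measure E3) (hmin : IsMinimizer τ ρ) (ψ : E3 → ℝ)
    (hψ : Measurable ψ) (C : ℝ) (hb : ∀ x, |ψ x| ≤ C) :
    0 ≤ ∫ z, Lfun τ z.1 z.2 * ψ z.1 * ψ z.2 ∂(ρ.prod ρ) := by
  have hC : 0 ≤ C := (abs_nonneg _).trans (hb 0)
  have h := L_pos_half τ ρ hmin (fun x => ψ x * (1 / (2 * (C + 1)))) (hψ.mul_const _) (fun x => by
    rw [abs_mul, abs_of_nonneg (a := 1 / (2 * (C + 1))) (by positivity), mul_one_div,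
      div_le_iff₀ (by positivity)]
    linarith [hb x])
  have e : ∫ z, Lfun τ z.1 z.2 * (ψ z.1 * (1 / (2 * (C + 1)))) * (ψ z.2 * (1 / (2 * (C + 1))))
      ∂(ρ.prod ρ) = (1 / (2 * (C + 1))) ^ 2 *
      ∫ z, Lfun τ z.1 z.2 * ψ z.1 * ψ z.2 ∂(ρ.prod ρ) := by
    rw [← integral_const_mul]
    refine integral_congr_ae (Filter.Eventually.of_forall fun z => ?_)
    simp only
    ring
  rw [e] at h
  exact nonneg_of_mul_nonneg_right h (by positivity)
open Topology in
lemma gram {ι : Type} [Fintype ι] [DecidableEq ι] (ρ : Measure E3) [IsProbabilityMeasure ρ]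
    (w : ι → ℝ) (φ : ι → E3 → ℝ) (hm : ∀ i, Measurable (φ i)) (C : ℝ) (hb : ∀ i x, |φ i x| ≤ C)
    (hpos : ∀ c : ι → ℝ, 0 ≤ ∑ i, w i * (∫ x, φ i x * ∑ j, c j * φ j x ∂ρ) ^ 2)
    (Φ : ι → ℝ) (hΦ : ∑ i, w i * Φ i ^ 2 < 0) :
    ∃ P : ι → ℝ, ∑ i, P i * Φ i ≠ 0 ∧ ∀ᵐ x ∂ρ, ∑ i, P i * φ i x = 0 := by
  have hint : ∀ i j, Integrable (fun x => φ i x * φ j x) ρ := fun i j => by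
    refine Integrable.of_bound (C := C * C) ((hm i).mul (hm j)).aestronglyMeasurable
      (Filter.Eventually.of_forall fun x => ?_)
    have hC : 0 ≤ C := (abs_nonneg _).trans (hb i x)
    rw [Real.norm_eq_abs, abs_mul]
    exact mul_le_mul (hb i x) (hb j x) (abs_nonneg _) hC
  let G : (ι → ℝ) →ₗ[ℝ] (ι → ℝ) := Matrix.mulVecLin (Matrix.of fun i j => ∫ x, φ i x * φ j x ∂ρ)
  have hG : ∀ c i, G c i = ∫ x, φ i x * ∑ j, c j * φ j x ∂ρ := by
    intro c i
    have : (fun x => φ i x * ∑ j, c j * φ j x) = fun x => ∑ j, c j * (φ i x * φ j x) := by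
      ext x
      rw [Finset.mul_sum]
      exact Finset.sum_congr rfl fun j _ => by ring
    rw [this, integral_finsetSum _ fun j _ => (hint i j).const_mul (c j)]
    simp only [G, Matrix.mulVecLin_apply, Matrix.mulVec, dotProduct, Matrix.of_apply,
      integral_const_mul]
    exact Finset.sum_congr rfl fun j _ => by ring
  have hnot : Φ ∉ LinearMap.range G := by
    rintro ⟨c, rfl⟩
    have := hpos c
    simp only [← hG] at this
    linarith
  obtain ⟨f, hf, hker⟩ := Submodule.exists_le_ker_of_notMem hnot
  have hfs : ∀ v : ι → ℝ, f v = ∑ i, f (Pi.single i 1) * v i := by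
    intro v
    rw [LinearMap.pi_apply_eq_sum_univ f v]
    refine Finset.sum_congr rfl fun i _ => ?_
    rw [smul_eq_mul, mul_comm]
    congr 2
    ext j
    simp [Pi.single_apply, eq_comm]
  set P : ι → ℝ := fun i => f (Pi.single i 1) with hP
  refine ⟨P, by rw [← hfs]; exact hf, ?_⟩
  have h0 : f (G P) = 0 := hker ⟨P, rfl⟩
  rw [hfs] at h0
  have hPi : Integrable (fun x => (∑ i, P i * φ i x) ^ 2) ρ := by
    have : (fun x => (∑ i, P i * φ i x) ^ 2) =
        fun x => ∑ i, ∑ j, (P i * P j) * (φ i x * φ j x) := by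
      ext x
      rw [sq, Finset.sum_mul_sum]
      exact Finset.sum_congr rfl fun i _ => Finset.sum_congr rfl fun j _ => by ring
    rw [this]
    exact integrable_finsetSum _ fun i _ => integrable_finsetSum _ fun j _ => (hint i j).const_mul _
  have h1 : ∫ x, (∑ i, P i * φ i x) ^ 2 ∂ρ = 0 := by
    rw [← h0]
    simp only [hG]
    simp only [← integral_const_mul]
    rw [← integral_finsetSum]
    · refine integral_congr_ae (Filter.Eventually.of_forall fun x => ?_)
      simp only [sq, Finset.sum_mul]
      exact Finset.sum_congr rfl fun i _ => by ring
    · intro i _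
      refine Integrable.const_mul ?_ _
      simp only [Finset.mul_sum]
      refine integrable_finsetSum _ fun j _ => ?_
      refine ((hint i j).const_mul (P j)).congr (Filter.Eventually.of_forall fun x => ?_)
      simp only
      ring
  rw [integral_eq_zero_iff_of_nonneg (fun x => sq_nonneg _) hPi] at h1
  filter_upwards [h1] with x hx
  simpa using hx
/-- Index set of the monomials of degree at most two. -/
abbrev FIdx := Unit ⊕ (Fin 3 ⊕ (Fin 3 × Fin 3))

/-- The monomials of degree at most two. -/
noncomputable def feat : FIdx → E3 → ℝ
  | Sum.inl _, _ => 1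
  | Sum.inr (Sum.inl i), x => x i
  | Sum.inr (Sum.inr p), x => x p.1 * x p.2

/-- The weights. -/
noncomputable def wgt (τ : ℝ) : FIdx → ℝ
  | Sum.inl _ => (2 - τ ^ 2) / 4
  | Sum.inr (Sum.inl _) => 1 / 2
  | Sum.inr (Sum.inr _) => τ ^ 2 / 4

/-- The test vector. -/
noncomputable def tvec : FIdx → ℝ
  | Sum.inl _ => 6
  | Sum.inr (Sum.inl _) => 0
  | Sum.inr (Sum.inr p) => if p.1 = p.2 then 2 else 0

lemma FIdx_sum (F : FIdx → ℝ) : ∑ i, F i = F (Sum.inl ()) +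
    ((F (Sum.inr (Sum.inl 0)) + F (Sum.inr (Sum.inl 1)) + F (Sum.inr (Sum.inl 2))) +
    ((F (Sum.inr (Sum.inr (0, 0))) + F (Sum.inr (Sum.inr (0, 1))) + F (Sum.inr (Sum.inr (0, 2)))) +
    (F (Sum.inr (Sum.inr (1, 0))) + F (Sum.inr (Sum.inr (1, 1))) + F (Sum.inr (Sum.inr (1, 2)))) +
    (F (Sum.inr (Sum.inr (2, 0))) + F (Sum.inr (Sum.inr (2, 1))) + F (Sum.inr (Sum.inr (2, 2)))))) := by
  simp only [Fintype.sum_sum_type, Fintype.sum_prod_type, Fin.sum_univ_three]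
  simp

lemma inner3 (x y : E3) : ⟪x, y⟫ = x 0 * y 0 + x 1 * y 1 + x 2 * y 2 := by
  simp [PiLp.inner_apply, Fin.sum_univ_three]
  ring

lemma D_feat (τ : ℝ) (x y : E3) : Dfun τ x y = ∑ i, wgt τ i * (feat i x * feat i y) := by
  rw [FIdx_sum]
  simp only [Dfun, inner3, wgt, feat]
  ring

lemma tvec_neg (τ : ℝ) (hτ : 3 < τ ^ 2) : ∑ i, wgt τ i * tvec i ^ 2 < 0 := by
  rw [FIdx_sum]
  simp [wgt, tvec]
  nlinarith

lemma feat_cont (i : FIdx) : Continuous (feat i) := by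
  rcases i with _ | i | p
  · exact continuous_const
  · exact EuclideanSpace.proj (𝕜 := ℝ) i |>.continuous
  · exact (EuclideanSpace.proj (𝕜 := ℝ) p.1 |>.continuous).mul
      (EuclideanSpace.proj (𝕜 := ℝ) p.2 |>.continuous)

lemma feat_bound (i : FIdx) (x : E3) (hx : x ∈ Sphere2) : |feat i x| ≤ 1 := by
  have h1 : ‖x‖ = 1 := by simpa [Sphere2] using hx
  have h : ∀ j, |x j| ≤ 1 := fun j => by
    have := PiLp.norm_apply_le x j
    rwa [h1, Real.norm_eq_abs] at this
  rcases i with _ | i | p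
  · simp [feat]
  · exact h i
  · simp only [feat, abs_mul]
    exact mul_le_one₀ (h _) (abs_nonneg _) (h _)

lemma sphere_closed : IsClosed Sphere2 := Metric.isClosed_sphere

lemma msupport_sub (ρ : Measure E3) (h : ρ Sphere2ᶜ = 0) : msupport ρ ⊆ Sphere2 := by
  intro x hx
  by_contra hn
  exact (hx _ sphere_closed.isOpen_compl hn).ne' h

lemma local_poly (τ : ℝ) (hτ : 3 < τ ^ 2) (ρ : Measure E3) (hmin : IsMinimizer τ ρ) (p : E3)
    (hp : p ∈ msupport ρ) : ∃ P : FIdx → ℝ, ∑ i, P i * tvec i ≠ 0 ∧ ∃ Ω : Set E3, IsOpen Ω ∧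
      p ∈ Ω ∧ ∀ x ∈ msupport ρ ∩ Ω, ∑ i, P i * feat i x = 0 := by
  have hprob := hmin.1
  have hS := hmin.2.2.1
  have hpS := msupport_sub ρ hS hp
  have hDc : Continuous (fun z : E3 × E3 => Dfun τ z.1 z.2) := by
    unfold Dfun; fun_prop
  have hDp : 0 < Dfun τ p p := by
    have h1 : ‖p‖ = 1 := by simpa [Sphere2] using hpS
    simp [Dfun, h1]
  have hop : IsOpen {z : E3 × E3 | 0 < Dfun τ z.1 z.2} := isOpen_lt continuous_const hDc
  obtain ⟨r, hr, hball⟩ := Metric.isOpen_iff.1 hop (p, p) hDp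
  rw [← ball_prod_same] at hball
  set Ω := Metric.ball p r with hΩ
  have hΩo : IsOpen Ω := Metric.isOpen_ball
  set A := Ω ∩ Sphere2 with hA
  have hAm : MeasurableSet A := hΩo.measurableSet.inter sphere_closed.measurableSet
  set φ : FIdx → E3 → ℝ := fun i => A.indicator (feat i) with hφ
  have hφm : ∀ i, Measurable (φ i) := fun i => (feat_cont i).measurable.indicator hAm
  have hφb : ∀ i x, |φ i x| ≤ 1 := by
    intro i x
    by_cases hx : x ∈ A
    · simp only [hφ, indicator_of_mem hx]; exact feat_bound i x hx.2
    · simp [hφ, indicator_of_notMem hx]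
  obtain ⟨P, hP, hae⟩ := gram ρ (wgt τ) φ hφm 1 hφb (by
    intro c
    set ψ : E3 → ℝ := fun x => ∑ j, c j * φ j x with hψ
    have hψm : Measurable ψ := Finset.measurable_fun_sum _ fun j _ => (hφm j).const_mul _
    have hψb : ∀ x, |ψ x| ≤ ∑ j, |c j| := by
      intro x
      refine (Finset.abs_sum_le_sum_abs _ _).trans (Finset.sum_le_sum fun j _ => ?_)
      rw [abs_mul]
      exact mul_le_of_le_one_right (abs_nonneg _) (hφb j x)
    have hψ0 : ∀ x, x ∉ A → ψ x = 0 := by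
      intro x hx
      simp [hψ, hφ, indicator_of_notMem hx]
    have hpos := L_pos τ ρ hmin ψ hψm _ hψb
    have hint : ∀ i, Integrable (fun x => φ i x * ψ x) ρ := fun i => by
      refine Integrable.of_bound (C := 1 * ∑ j, |c j|) ((hφm i).mul hψm).aestronglyMeasurable
        (Filter.Eventually.of_forall fun x => ?_)
      rw [Real.norm_eq_abs, abs_mul]
      exact mul_le_mul (hφb i x) (hψb x) (abs_nonneg _) zero_le_one
    have e : ∀ z : E3 × E3, Lfun τ z.1 z.2 * ψ z.1 * ψ z.2 =
        ∑ i, wgt τ i * ((φ i z.1 * ψ z.1) * (φ i z.2 * ψ z.2)) := by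
      rintro ⟨x, y⟩
      by_cases hx : x ∈ A
      · by_cases hy : y ∈ A
        · have hD : 0 < Dfun τ x y := hball (Set.mk_mem_prod hx.1 hy.1)
          simp only [Lfun]
          rw [max_eq_right hD.le, D_feat, Finset.sum_mul, Finset.sum_mul]
          refine Finset.sum_congr rfl fun i _ => ?_
          simp only [hφ, indicator_of_mem hx, indicator_of_mem hy]
          ring
        · simp [hψ0 y hy]
      · simp [hψ0 x hx]
    simp only [e] at hpos
    rw [integral_finsetSum _ fun i _ => ((hint i).mul_prod (hint i)).const_mul _] at hpos
    refine hpos.trans (le_of_eq (Finset.sum_congr rfl fun i _ => ?_))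
    rw [integral_const_mul, integral_prod_mul (fun x => φ i x * ψ x) (fun x => φ i x * ψ x), sq])
    tvec (tvec_neg τ hτ)
  refine ⟨P, hP, Ω, hΩo, Metric.mem_ball_self hr, ?_⟩
  rintro x ⟨hxM, hxΩ⟩
  by_contra hne
  have hqc : Continuous (fun x => ∑ i, P i * feat i x) :=
    continuous_finsetSum _ fun i _ => continuous_const.mul (feat_cont i)
  have hU : IsOpen (Ω ∩ {x | ∑ i, P i * feat i x ≠ 0}) :=
    hΩo.inter (isOpen_ne_fun hqc continuous_const)
  refine (hxM _ hU ⟨hxΩ, hne⟩).ne' ?_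
  have h2 : ∀ᵐ x ∂ρ, x ∉ Ω ∩ {x | ∑ i, P i * feat i x ≠ 0} := by
    filter_upwards [hae, sphere_ae ρ hS] with x h3 h4 h5
    refine h5.2 ?_
    have hx : x ∈ A := ⟨h5.1, h4⟩
    simpa only [hφ, indicator_of_mem hx] using h3
  have h6 := measure_eq_zero_iff_ae_notMem.2 h2
  exact h6

open Polynomial in
/-- The polynomial in stereographic coordinates. -/
noncomputable def Qpoly (P : FIdx → ℝ) : ℝ[X][X] :=
  let U : ℝ[X][X] := C X
  let V : ℝ[X][X] := X
  let q := 1 + U ^ 2 + V ^ 2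
  let s : Fin 3 → ℝ[X][X] := ![2 * U, 2 * V, U ^ 2 + V ^ 2 - 1]
  C (C (P (Sum.inl ()))) * q ^ 2 + (∑ i, C (C (P (Sum.inr (Sum.inl i)))) * s i * q) +
    ∑ i, ∑ j, C (C (P (Sum.inr (Sum.inr (i, j))))) * s i * s j

open Polynomial in
lemma Qpoly_eval (P : FIdx → ℝ) (z : ℝ × ℝ) : (Qpoly P).evalEval z.1 z.2 =
    (1 + z.1 ^ 2 + z.2 ^ 2) ^ 2 * ∑ i, P i * feat i (stereoF z) := by
  have hq : 1 + z.1 ^ 2 + z.2 ^ 2 ≠ 0 := by positivity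
  rw [FIdx_sum]
  simp only [feat, stereoF, mkE3_0, mkE3_1, mkE3_2, Qpoly, Fin.sum_univ_three]
  have e2 : (2 : ℝ[X][X]).evalEval z.1 z.2 = 2 := evalEval_natCast z.1 z.2 2
  simp only [evalEval_add, evalEval_mul, evalEval_pow, evalEval_one, evalEval_C, evalEval_X, eval_C,
    evalEval_sub, Matrix.cons_val, eval_X, e2]
  field_simp
  ring

lemma Qpoly_ne (P : FIdx → ℝ) (hP : ∑ i, P i * tvec i ≠ 0) : Qpoly P ≠ 0 := by
  intro h0
  have hz : ∀ x ∈ Sphere2, x 2 ≠ 1 → ∑ i, P i * feat i x = 0 := by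
    intro x hx h2
    obtain ⟨z, rfl⟩ := stereoF_surj x hx h2
    have := Qpoly_eval P z
    rw [h0, Polynomial.evalEval_zero] at this
    have hq : (1 + z.1 ^ 2 + z.2 ^ 2) ^ 2 ≠ 0 := by positivity
    exact (mul_eq_zero.1 this.symm).resolve_left hq
  have h : ∀ a b c : ℝ, a ^ 2 + b ^ 2 + c ^ 2 = 1 → c ≠ 1 → ∑ i, P i * feat i (mkE3 a b c) = 0 :=
    fun a b c h1 h2 => hz _ ((mem_Sphere2_iff _).2 h1) h2
  have a1 := h 1 0 0 (by norm_num) (by norm_num)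
  have a2 := h (-1) 0 0 (by norm_num) (by norm_num)
  have a3 := h 0 (3/5) (4/5) (by norm_num) (by norm_num)
  have a4 := h 0 (-3/5) (-4/5) (by norm_num) (by norm_num)
  have a5 := h 0 (-4/5) (3/5) (by norm_num) (by norm_num)
  have a6 := h 0 (4/5) (-3/5) (by norm_num) (by norm_num)
  rw [FIdx_sum] at a1 a2 a3 a4 a5 a6 hP
  simp only [feat, mkE3_0, mkE3_1, mkE3_2] at a1 a2 a3 a4 a5 a6
  apply hP
  simp [tvec]
  linarith


/-- Proposition 6.2: if `M` has no uniform two-sided accumulation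
points of scaling `β` (on real analytic arc-length curves), then the Hausdorff
dimension of `M` is at most `1/(1+β)`. -/
theorem stmt_10 (τ β : ℝ) (hτ : Real.sqrt 3 < τ) (hβ : 0 < β)
    (ρ : Measure E3) (hmin : IsMinimizer τ ρ)
    (hno : ¬ ∃ (p : E3) (δ : ℝ) (γ : ℝ → E3),
        p ∈ msupport ρ ∧ 0 < δ ∧ γ 0 = p ∧
        AnalyticOnNhd ℝ γ (Set.Ioo (-δ) δ) ∧
        (∀ t ∈ Set.Ioo (-δ) δ, γ t ∈ Sphere2) ∧
        (∀ t ∈ Set.Ioo (-δ) δ, ‖deriv γ t‖ = 1) ∧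
        UniformTwoSidedAcc (msupport ρ) β δ γ) :
    dimH (msupport ρ) ≤ ENNReal.ofReal (1 / (1 + β)) := by

  have hτ2 : 3 < τ ^ 2 := by
    have h0 := Real.sqrt_nonneg 3
    have h1 := Real.sq_sqrt (show (0:ℝ) ≤ 3 by norm_num)
    nlinarith
  by_contra hlt
  rw [not_le] at hlt
  obtain ⟨p, hp, hloc⟩ := exists_mem_nhdsWithin_lt_dimH_of_lt_dimH hlt
  obtain ⟨P, hP, Ω, hΩ, hpΩ, hz⟩ := local_poly τ hτ2 ρ hmin p hp
  have h1 := hloc (msupport ρ ∩ Ω) (inter_mem_nhdsWithin _ (hΩ.mem_nhds hpΩ))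
  refine absurd h1 (not_lt.2 ?_)
  have hsub : msupport ρ ∩ Ω ⊆
      (msupport ρ ∩ stereoF '' {z | (Qpoly P).evalEval z.1 z.2 = 0}) ∪ {mkE3 0 0 1} := by
    intro x hx
    have hxS := msupport_sub ρ hmin.2.2.1 hx.1
    by_cases h2 : x 2 = 1
    · right
      rw [mem_Sphere2_iff, h2] at hxS
      have e0 : x 0 = 0 := by nlinarith [sq_nonneg (x 0), sq_nonneg (x 1)]
      have e1 : x 1 = 0 := by nlinarith [sq_nonneg (x 0), sq_nonneg (x 1)]
      rw [Set.mem_singleton_iff]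
      ext i
      fin_cases i
      · exact e0
      · exact e1
      · exact h2
    · left
      obtain ⟨z, rfl⟩ := stereoF_surj x hxS h2
      refine ⟨hx.1, z, ?_, rfl⟩
      change (Qpoly P).evalEval z.1 z.2 = 0
      rw [Qpoly_eval, hz _ hx, mul_zero]
  refine (dimH_mono hsub).trans ?_
  rw [dimH_union, dimH_singleton]
  exact max_le (zero_set_dim (msupport ρ) β hβ hno _ _ (Qpoly_ne P hP) le_rfl) zero_le
end
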